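/- arXiv:2001.10706 — 5 statements merged into one kernel-verified Lean document; each statement's English description precedes it below -/
import Mathlib

section
/- For any centered isotropic measure μ on S^{n−1}, there exists a discrete centered isotropic measure μ_0 on S^{n−1} such that supp μ_0 ⊆ supp μ and the support of μ_0 has at most 2n² points. -/
open MeasureTheory Metric Set
open scoped RealInnerProductSpace ENNReal

noncomputable section

/-- The (topological) support of a measure: points all of whose open neighbourhoods have
positive measure. -/
def msupp {n : ℕ} (μ : Measure (EuclideanSpace ℝ (Fin n))) : Set (EuclideanSpace ℝ (Fin n)) :=
  {x | ∀ U : Set (EuclideanSpace ℝ (Fin n)), IsOpen U → x ∈ U → μ U ≠ 0}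

/-- `μ` is a centered isotropic (Borel) measure on the unit sphere `S^{n-1}`. -/
def IsCenteredIsotropic {n : ℕ} (μ : Measure (EuclideanSpace ℝ (Fin n))) : Prop :=
  msupp μ ⊆ sphere (0 : EuclideanSpace ℝ (Fin n)) 1 ∧
  (∀ x : EuclideanSpace ℝ (Fin n), ∫ u, ⟪u, x⟫ ^ 2 ∂μ = ‖x‖ ^ 2) ∧
  (∫ u, u ∂μ) = 0

namespace IsoProof

variable {n : ℕ}

/-- The moment map. -/
def Phi (u : EuclideanSpace ℝ (Fin n)) : (EuclideanSpace ℝ (Fin n)) × (Fin n → Fin n → ℝ) := (u, fun i j => u i * u j)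

lemma Phi_cont : Continuous (Phi (n := n)) := by
  unfold Phi; fun_prop

/-- The quadratic form functional. -/
def Lx (x : EuclideanSpace ℝ (Fin n)) : ((EuclideanSpace ℝ (Fin n)) × (Fin n → Fin n → ℝ)) →ₗ[ℝ] ℝ where
  toFun p := ∑ i, ∑ j, x i * x j * p.2 i j
  map_add' p q := by simp [mul_add, Finset.sum_add_distrib]
  map_smul' c p := by
    simp only [Prod.smul_snd, Pi.smul_apply, smul_eq_mul, RingHom.id_apply, Finset.mul_sum]
    refine Finset.sum_congr rfl fun i _ => Finset.sum_congr rfl fun j _ => by ring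

/-- The trace functional. -/
def Tr : ((EuclideanSpace ℝ (Fin n)) × (Fin n → Fin n → ℝ)) →ₗ[ℝ] ℝ where
  toFun p := ∑ i, p.2 i i
  map_add' p q := by simp [Finset.sum_add_distrib]
  map_smul' c p := by simp [Finset.mul_sum]

lemma Lx_Phi (x u : EuclideanSpace ℝ (Fin n)) : Lx x (Phi u) = ⟪u, x⟫ ^ 2 := by
  simp only [Lx, Phi, LinearMap.coe_mk, AddHom.coe_mk, PiLp.inner_apply, pow_two,
    Finset.sum_mul_sum]
  refine Finset.sum_congr rfl fun i _ => Finset.sum_congr rfl fun j _ => ?_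
  simp; ring

lemma Tr_Phi (u : EuclideanSpace ℝ (Fin n)) : Tr (Phi u) = ‖u‖ ^ 2 := by
  rw [EuclideanSpace.norm_sq_eq]
  simp [Tr, Phi, pow_two]

lemma ae_msupp (μ : Measure (EuclideanSpace ℝ (Fin n))) : ∀ᵐ x ∂μ, x ∈ msupp μ := by
  change μ (msupp μ)ᶜ = 0
  refine measure_null_of_locally_null _ fun x hx => ?_
  simp only [msupp, mem_compl_iff, mem_ofPred_eq, not_forall, not_not] at hx
  obtain ⟨U, hU, hxU, h0⟩ := hx
  exact ⟨U, mem_nhdsWithin_of_mem_nhds (hU.mem_nhds hxU), h0⟩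

lemma isClosed_msupp (μ : Measure (EuclideanSpace ℝ (Fin n))) : IsClosed (msupp μ) := by
  rw [← isOpen_compl_iff, isOpen_iff_forall_mem_open]
  intro x hx
  simp only [msupp, mem_compl_iff, mem_ofPred_eq, not_forall, not_not] at hx
  obtain ⟨U, hU, hxU, h0⟩ := hx
  exact ⟨U, fun y hy h => h U hU hy h0, hU, hxU⟩

lemma finite_of (μ : Measure (EuclideanSpace ℝ (Fin n))) (hμ : IsCenteredIsotropic μ) : IsFiniteMeasure μ := by
  obtain ⟨h1, h2, h3⟩ := hμ
  have hi : ∀ i : Fin n, Integrable (fun u : EuclideanSpace ℝ (Fin n) => (u i) ^ 2) μ := by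
    intro i
    by_contra hc
    have := h2 (EuclideanSpace.single i 1)
    rw [integral_undef (by simpa [EuclideanSpace.inner_single_right] using hc)] at this
    simp at this
  have hs : Integrable (fun u : EuclideanSpace ℝ (Fin n) => ∑ i, (u i) ^ 2) μ :=
    integrable_finsetSum _ fun i _ => hi i
  have h1' : Integrable (fun _ : EuclideanSpace ℝ (Fin n) => (1 : ℝ)) μ := by
    refine hs.congr ?_
    filter_upwards [ae_msupp μ] with u hu
    have := h1 hu
    have h4 := EuclideanSpace.norm_sq_eq u
    rw [mem_sphere_zero_iff_norm.1 this] at h4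
    simpa using h4.symm
  exact (integrable_const_iff_isFiniteMeasure one_ne_zero).1 h1'

lemma isCompact_hull {V : Type*} [NormedAddCommGroup V] [NormedSpace ℝ V]
    [FiniteDimensional ℝ V] {K : Set V} (hK : IsCompact K) : IsCompact (convexHull ℝ K) := by
  rcases K.eq_empty_or_nonempty with rfl | ⟨p0, hp0⟩
  · simp
  let m := Module.finrank ℝ V + 1
  have hc : IsCompact (stdSimplex ℝ (Fin m) ×ˢ (univ.pi fun _ : Fin m => K)) :=
    (isCompact_stdSimplex ℝ (Fin m)).prod (isCompact_univ_pi fun _ => hK)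
  have hcont : Continuous (fun q : (Fin m → ℝ) × (Fin m → V) => ∑ k, q.1 k • q.2 k) := by
    fun_prop
  convert hc.image hcont using 1
  ext x
  constructor
  · intro hx
    obtain ⟨ι, _, z, w, hz, haff, hw, hw1, hsum⟩ := eq_pos_convex_span_of_mem_convexHull hx
    have hcard : Fintype.card ι ≤ Fintype.card (Fin m) := by
      rw [Fintype.card_fin]
      exact haff.card_le_finrank_succ.trans (Nat.succ_le_succ (Submodule.finrank_le _))
    obtain ⟨e⟩ := Function.Embedding.nonempty_of_card_le hcard
    have hW : ∀ i, Function.extend e w 0 (e i) = w i := fun i => e.injective.extend_apply _ _ _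
    have hZ : ∀ i, Function.extend e z (fun _ => p0) (e i) = z i :=
      fun i => e.injective.extend_apply _ _ _
    have hW0 : ∀ k ∉ range e, Function.extend e w 0 k = 0 := fun k hk =>
      Function.extend_apply' _ _ _ hk
    have hZ0 : ∀ k ∉ range e, Function.extend e z (fun _ => p0) k = p0 := fun k hk =>
      Function.extend_apply' _ _ _ hk
    refine ⟨(Function.extend e w 0, Function.extend e z (fun _ => p0)), ⟨⟨?_, ?_⟩, ?_⟩, ?_⟩
    · intro k
      by_cases hk : k ∈ range e
      · obtain ⟨i, rfl⟩ := hk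
        simpa only [hW] using (hw i).le
      · simp only [hW0 k hk, le_refl]
    · rw [← hw1]
      exact (Fintype.sum_of_injective e e.injective _ _ hW0 fun i => (hW i).symm).symm
    · intro k _
      by_cases hk : k ∈ range e
      · obtain ⟨i, rfl⟩ := hk
        simpa only [hZ] using hz ⟨i, rfl⟩
      · simpa only [hZ0 k hk] using hp0
    · rw [← hsum]
      refine (Fintype.sum_of_injective e e.injective _ _ (fun k hk => ?_) fun i => ?_).symm
      · simp only [hW0 k hk, zero_smul]
      · simp only [hW, hZ]
  · rintro ⟨q, ⟨hq1, hq2⟩, rfl⟩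
    exact (convex_convexHull ℝ K).sum_mem (fun k _ => hq1.1 k) hq1.2
      fun k _ => subset_convexHull ℝ K (hq2 k (mem_univ k))

lemma main (hn : 1 ≤ n) (μ : Measure (EuclideanSpace ℝ (Fin n))) (hμ : IsCenteredIsotropic μ) :
    ∃ μ₀ : Measure (EuclideanSpace ℝ (Fin n)), IsCenteredIsotropic μ₀ ∧
      msupp μ₀ ⊆ msupp μ ∧ (msupp μ₀).Finite ∧ (msupp μ₀).ncard ≤ 2 * n ^ 2 := by
  have := finite_of μ hμ
  obtain ⟨h1, h2, h3⟩ := hμ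
  have hne : μ ≠ 0 := by
    rintro rfl
    have := h2 (EuclideanSpace.single ⟨0, hn⟩ 1)
    simp at this
  have : NeZero μ := ⟨hne⟩
  have hcomp : IsCompact (msupp μ) :=
    (isCompact_sphere (0 : EuclideanSpace ℝ (Fin n)) 1).of_isClosed_subset (isClosed_msupp μ) h1
  have hK : IsCompact (Phi '' msupp μ) := hcomp.image Phi_cont
  obtain ⟨C, hC⟩ := hK.isBounded.exists_norm_le
  have hint : Integrable (Phi (n := n)) μ := by
    refine Integrable.of_bound Phi_cont.aestronglyMeasurable C ?_
    filter_upwards [ae_msupp μ] with u hu using hC _ (mem_image_of_mem _ hu)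
  have hav : (⨍ u, Phi u ∂μ) ∈ convexHull ℝ (Phi '' msupp μ) := by
    refine (convex_convexHull ℝ _).average_mem (isCompact_hull hK).isClosed ?_ hint
    filter_upwards [ae_msupp μ] with u hu using subset_convexHull ℝ _ (mem_image_of_mem _ hu)
  obtain ⟨ι, _, z, w, hz, haff, hw, hw1, hsum⟩ := eq_pos_convex_span_of_mem_convexHull hav
  have hz' : ∀ i, ∃ y ∈ msupp μ, Phi y = z i := fun i => hz ⟨i, rfl⟩
  choose y hy hyz using hz'
  have hyn : ∀ i, ‖y i‖ = 1 := fun i => mem_sphere_zero_iff_norm.1 (h1 (hy i))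
  have hTr : ∀ i, Tr (z i) = 1 := fun i => by rw [← hyz, Tr_Phi, hyn]; norm_num
  have hlin : LinearIndependent ℝ z := by
    rw [linearIndependent_iff']
    intro s g hg
    refine affineIndependent_iff.1 haff s g ?_ hg
    have := congrArg Tr hg
    simpa [map_sum, hTr] using this
  have hcard : Fintype.card ι ≤ 2 * n ^ 2 := by
    have := hlin.fintype_card_le_finrank
    simp [Module.finrank_prod, Module.finrank_pi_fintype] at this
    nlinarith
  set M := μ.real univ with hM
  have hMpos : 0 < M := by
    rw [hM, measureReal_def]
    exact ENNReal.toReal_pos (by simpa using hne) (measure_ne_top _ _)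
  have hc : ∀ i, 0 ≤ M * w i := fun i => (mul_pos hMpos (hw i)).le
  have hsum' : ∑ i, (M * w i) • Phi (y i) = ∫ u, Phi u ∂μ := by
    rw [average_eq] at hsum
    simp only [mul_smul, hyz, ← Finset.smul_sum, hsum]
    rw [smul_smul, mul_inv_cancel₀ hMpos.ne', one_smul]
  let μ₀ : Measure (EuclideanSpace ℝ (Fin n)) := ∑ i, ENNReal.ofReal (M * w i) • Measure.dirac (y i)
  have hI : ∀ {F : Type} [NormedAddCommGroup F] [NormedSpace ℝ F] [CompleteSpace F]
      (f : (EuclideanSpace ℝ (Fin n)) → F), ∫ u, f u ∂μ₀ = ∑ i, (M * w i) • f (y i) := by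
    intro F _ _ _ f
    rw [integral_finsetSum_measure]
    · refine Finset.sum_congr rfl fun i _ => ?_
      rw [integral_smul_measure, integral_dirac, ENNReal.toReal_ofReal (hc i)]
    · intro i _
      exact (integrable_dirac (by simp)).smul_measure ENNReal.ofReal_ne_top
  have hsub : msupp μ₀ ⊆ range y := by
    intro x hx
    by_contra hxr
    refine hx (range y)ᶜ (finite_range y).isClosed.isOpen_compl hxr ?_
    simp only [μ₀, Measure.finsetSum_apply]
    refine Finset.sum_eq_zero fun i _ => ?_
    simp
  have hsub2 : range y ⊆ msupp μ := by rintro _ ⟨i, rfl⟩; exact hy i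
  refine ⟨μ₀, ⟨fun x hx => h1 (hsub2 (hsub hx)), fun x => ?_, ?_⟩, hsub.trans hsub2,
    (finite_range y).subset hsub, ?_⟩
  · rw [hI, ← h2 x]
    have h := (LinearMap.toContinuousLinearMap (Lx x)).integral_comp_comm hint
    simp only [LinearMap.coe_toContinuousLinearMap', Lx_Phi] at h
    rw [h, ← hsum', map_sum]
    simp [Lx_Phi]
  · rw [hI, ← h3]
    have h := (ContinuousLinearMap.fst ℝ (EuclideanSpace ℝ (Fin n)) (Fin n → Fin n → ℝ)).integral_comp_comm hint
    rw [← hsum', map_sum] at h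
    simpa [Phi] using h.symm
  · refine (ncard_le_ncard hsub (finite_range y)).trans (le_trans ?_ hcard)
    rw [← image_univ, ← Nat.card_eq_fintype_card, ← ncard_univ]
    exact ncard_image_le finite_univ

end IsoProof

theorem exists_discrete_isotropic
    (n : ℕ) (hn : 1 ≤ n) (μ : Measure (EuclideanSpace ℝ (Fin n)))
    (hμ : IsCenteredIsotropic μ) :
    ∃ μ₀ : Measure (EuclideanSpace ℝ (Fin n)), IsCenteredIsotropic μ₀ ∧
      msupp μ₀ ⊆ msupp μ ∧ (msupp μ₀).Finite ∧ (msupp μ₀).ncard ≤ 2 * n ^ 2 := by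
  exact IsoProof.main hn μ hμ

end
end

section
/- Let k ≥ n+1, let t_1,…,t_k > 0, c_1,…,c_k > 0 and u_1,…,u_k ∈ S^{n−1} satisfy Σ_{i=1}^k c_i u_i⊗u_i = Id_n. Then det(Σ_{i=1}^k t_i c_i u_i⊗u_i) ≥ θ* · Π_{i=1}^k t_i^{c_i}, where θ* = 1 + (1/2) Σ_{1≤i_1<…<i_n≤k} c_{i_1}⋯c_{i_n} det[u_{i_1},…,u_{i_n}]² ( √(t_{i_1}⋯t_{i_n})/t_0 − 1 )² and t_0 = ( Σ_{1≤i_1<…<i_n≤k} t_{i_1}⋯t_{i_n} c_{i_1}⋯c_{i_n} det[u_{i_1},…,u_{i_n}]² )^{1/2}. -/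
open MeasureTheory Metric Set
open scoped RealInnerProductSpace ENNReal

noncomputable section

/-- The squared determinant `det[u_{i_1},…,u_{i_n}]²` of the matrix whose columns are the
vectors `u_i`, `i ∈ s`, listed in increasing order (the square does not depend on the order). -/
def subDetSq (n k : ℕ) (u : Fin k → EuclideanSpace ℝ (Fin n))
    (s : Finset (Fin k)) (h : s.card = n) : ℝ :=
  (Matrix.det (Matrix.of fun (r j : Fin n) => u ((s.orderIsoOfFin h) j : Fin k) r)) ^ 2

/-- `t_0 = (Σ_{i_1<…<i_n} t_{i_1}⋯t_{i_n} c_{i_1}⋯c_{i_n} det[u_{i_1},…,u_{i_n}]²)^{1/2}`. -/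
def tZero (n k : ℕ) (t c : Fin k → ℝ) (u : Fin k → EuclideanSpace ℝ (Fin n)) : ℝ :=
  Real.sqrt (∑ s ∈ (Finset.powersetCard n (Finset.univ : Finset (Fin k))).attach,
    (∏ i ∈ s.1, t i) * (∏ i ∈ s.1, c i) *
      subDetSq n k u s.1 (Finset.mem_powersetCard.mp s.2).2)

/-- `θ* = 1 + (1/2) Σ_{i_1<…<i_n} c_{i_1}⋯c_{i_n} det[u_{i_1},…,u_{i_n}]²
  (√(t_{i_1}⋯t_{i_n})/t_0 − 1)²`. -/
def thetaStar (n k : ℕ) (t c : Fin k → ℝ) (u : Fin k → EuclideanSpace ℝ (Fin n)) : ℝ :=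
  1 + (1 / 2) * ∑ s ∈ (Finset.powersetCard n (Finset.univ : Finset (Fin k))).attach,
    (∏ i ∈ s.1, c i) * subDetSq n k u s.1 (Finset.mem_powersetCard.mp s.2).2 *
      (Real.sqrt (∏ i ∈ s.1, t i) / tZero n k t c u - 1) ^ 2

/-- Sum over the injective maps, grouped by image. -/
theorem sum_inj_group (n k : ℕ) (F : (Fin n → Fin k) → ℝ)
    (hF : ∀ f, ¬ Function.Injective f → F f = 0) :
    ∑ f, F f = ∑ s ∈ (Finset.powersetCard n (Finset.univ : Finset (Fin k))).attach,
      ∑ σ : Equiv.Perm (Fin n),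
        F (fun j => s.1.orderEmbOfFin (Finset.mem_powersetCard.mp s.2).2 (σ j)) := by
  rw [Finset.sum_sigma']
  symm
  refine Finset.sum_of_injOn (fun p => fun j =>
    p.1.1.orderEmbOfFin (Finset.mem_powersetCard.mp p.1.2).2 (p.2 j)) ?_ ?_ ?_ ?_
  · rintro ⟨⟨s, hs⟩, σ⟩ _ ⟨⟨s2, hs2⟩, σ2⟩ _ h
    simp only at h
    have hr : ∀ (s : Finset (Fin k)) (hs : s.card = n) (σ : Equiv.Perm (Fin n)),
        Set.range (fun j => s.orderEmbOfFin hs (σ j)) = (s : Set (Fin k)) := by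
      intro s hs σ
      have := σ.surjective.range_comp (s.orderEmbOfFin hs)
      rw [Finset.range_orderEmbOfFin] at this
      exact this
    have e : s = s2 := by
      have h1 := hr s (Finset.mem_powersetCard.mp hs).2 σ
      have h2 := hr s2 (Finset.mem_powersetCard.mp hs2).2 σ2
      rw [h, h2] at h1
      exact_mod_cast h1.symm
    subst e
    have : σ = σ2 := by
      ext j
      have := congrFun h j
      have h3 : σ j = σ2 j := by simpa using this
      rw [h3]
    subst this
    rfl
  · intro _ _
    simp
  · intro f _ hf
    apply hF
    intro hinj
    apply hf
    have hc : (Finset.univ.image f).card = n := by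
      rw [Finset.card_image_of_injective _ hinj]; simp
    let e := (Finset.univ.image f).orderIsoOfFin hc
    let g : Fin n → Fin n := fun j => e.symm ⟨f j, by simp⟩
    have hg : Function.Injective g := by
      intro a b hab
      have := e.symm.injective hab
      exact hinj (by simpa using this)
    refine ⟨⟨⟨Finset.univ.image f, Finset.mem_powersetCard.mpr ⟨by simp, hc⟩⟩,
      Equiv.ofBijective g (Finite.injective_iff_bijective.mp hg)⟩, by simp, ?_⟩
    funext j
    change (Finset.univ.image f).orderEmbOfFin hc (g j) = f j
    rw [← Finset.coe_orderIsoOfFin_apply]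
    change ((e (e.symm _)) : Fin k) = _
    simp
  · intro _ _
    rfl

/-- Cauchy-Binet in the form needed here. -/
theorem cauchy_binet (n k : ℕ) (a : Fin k → ℝ) (u : Fin k → EuclideanSpace ℝ (Fin n)) :
    Matrix.det (Matrix.of fun (r q : Fin n) => ∑ i, a i * u i r * u i q) =
    ∑ s ∈ (Finset.powersetCard n (Finset.univ : Finset (Fin k))).attach,
      (∏ i ∈ s.1, a i) * subDetSq n k u s.1 (Finset.mem_powersetCard.mp s.2).2 := by
  have h1 : Matrix.det (Matrix.of fun (r q : Fin n) => ∑ i, a i * u i r * u i q) =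
      ∑ f : Fin n → Fin k, (∏ r, (a (f r) * u (f r) r)) *
        Matrix.det (Matrix.of fun (r q : Fin n) => u (f r) q) := by
    have := (Matrix.detRowAlternating (n := Fin n) (R := ℝ)).toMultilinearMap.map_sum
      (α := fun _ => Fin k) (fun r i => fun q => a i * u i r * u i q)
    have e : (fun r : Fin n => ∑ i, (fun q => a i * u i r * u i q)) =
        (Matrix.of fun (r q : Fin n) => ∑ i, a i * u i r * u i q) := by
      ext r q
      simp [Finset.sum_apply]
    rw [e] at this
    refine Eq.trans this (Finset.sum_congr rfl fun f _ => ?_)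
    exact Matrix.det_mul_column (fun r => a (f r) * u (f r) r)
      (Matrix.of fun (r q : Fin n) => u (f r) q)
  rw [h1, sum_inj_group]
  · refine Finset.sum_congr rfl fun s _ => ?_
    set e := s.1.orderEmbOfFin (Finset.mem_powersetCard.mp s.2).2 with he
    have hp : ∀ σ : Equiv.Perm (Fin n), ∏ r, a (e (σ r)) = ∏ i ∈ s.1, a i := by
      intro σ
      rw [Equiv.prod_comp σ (fun r => a (e r))]
      rw [← Finset.image_orderEmbOfFin_univ s.1 (Finset.mem_powersetCard.mp s.2).2,
        Finset.prod_image (fun x _ y _ h => e.injective h)]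
    have hd : ∀ σ : Equiv.Perm (Fin n),
        Matrix.det (Matrix.of fun (r q : Fin n) => u (e (σ r)) q) =
        (Equiv.Perm.sign σ : ℝ) * Matrix.det (Matrix.of fun (r q : Fin n) => u (e r) q) := by
      intro σ
      rw [← Matrix.det_permute]
      rfl
    have hs : subDetSq n k u s.1 (Finset.mem_powersetCard.mp s.2).2 =
        Matrix.det (Matrix.of fun (r q : Fin n) => u (e r) q) ^ 2 := by
      unfold subDetSq
      rw [← Matrix.det_transpose]
      rfl
    rw [hs, sq]
    have hdd : Matrix.det (Matrix.of fun (r q : Fin n) => u (e r) q) =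
        ∑ σ : Equiv.Perm (Fin n), (Equiv.Perm.sign σ : ℝ) * ∏ r, u (e (σ r)) r :=
      Matrix.det_apply' _
    conv_rhs => rw [← mul_assoc]; right; rw [hdd]
    rw [Finset.mul_sum]
    refine Finset.sum_congr rfl fun σ _ => ?_
    rw [Finset.prod_mul_distrib, hp, hd]
    ring
  · intro f hf
    rw [Function.Injective] at hf
    push Not at hf
    obtain ⟨i, j, hij, hne⟩ := hf
    rw [Matrix.det_zero_of_row_eq hne, mul_zero]
    ext q
    simp [hij]

theorem iso_matrix (n k : ℕ) (c : Fin k → ℝ) (u : Fin k → EuclideanSpace ℝ (Fin n))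
    (hiso : ∀ x : EuclideanSpace ℝ (Fin n), ‖x‖ ^ 2 = ∑ i, c i * ⟪u i, x⟫ ^ 2) (r q : Fin n) :
    ∑ i, c i * u i r * u i q = (1 : Matrix (Fin n) (Fin n) ℝ) r q := by
  have hd : ∀ r, ∑ i, c i * u i r ^ 2 = 1 := by
    intro r
    have := hiso (EuclideanSpace.single r 1)
    simp [EuclideanSpace.inner_single_right] at this
    exact this.symm
  by_cases h : r = q
  · subst h
    rw [Matrix.one_apply_eq, ← hd r]
    exact Finset.sum_congr rfl fun i _ => by ring
  · rw [Matrix.one_apply_ne h]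
    have h1 := hiso (EuclideanSpace.single r 1 + EuclideanSpace.single q 1)
    rw [norm_add_sq_real] at h1
    simp [EuclideanSpace.inner_single_right, inner_add_right, h] at h1
    have h2 : ∑ i, c i * (u i r + u i q) ^ 2 =
        ∑ i, c i * u i r ^ 2 + ∑ i, c i * u i q ^ 2 + 2 * ∑ i, c i * u i r * u i q := by
      rw [Finset.mul_sum, ← Finset.sum_add_distrib, ← Finset.sum_add_distrib]
      exact Finset.sum_congr rfl fun i _ => by ring
    rw [h2, hd, hd] at h1
    linarith

theorem final_ineq (A T P : ℝ) (hP : 0 < P) (h1 : P ≤ A) (h2 : A ≤ T) :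
    (1 + (1 / 2) * (2 - 2 * (A / T))) * P ^ 2 ≤ T ^ 2 := by
  have hT : 0 < T := by linarith
  have hPT : P ≤ T := by linarith
  have h3 : P / T ≤ A / T := by gcongr
  have h4 : (1 + (1 / 2) * (2 - 2 * (A / T))) * P ^ 2 ≤ (2 - P / T) * P ^ 2 := by
    apply mul_le_mul_of_nonneg_right _ (sq_nonneg P)
    linarith
  refine h4.trans ?_
  have h5 : T ^ 2 - (2 - P / T) * P ^ 2 = (T - P) * (T ^ 2 + T * P - P ^ 2) / T := by
    field_simp
    ring
  have h6 : 0 ≤ (T - P) * (T ^ 2 + T * P - P ^ 2) / T := by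
    apply div_nonneg (mul_nonneg (by linarith) (by nlinarith)) hT.le
  linarith

/-- The abstract inequality, for a probability weight `w` on sets with marginals `c`. -/
theorem weighted_ineq {k : ℕ} {ι : Type*} (S : Finset ι) (m : ι → Finset (Fin k)) (w : ι → ℝ)
    (hw : ∀ s ∈ S, 0 ≤ w s) (hw1 : ∑ s ∈ S, w s = 1) (t c : Fin k → ℝ) (ht : ∀ i, 0 < t i)
    (hm : ∀ i, ∑ s ∈ S, (if i ∈ m s then w s else 0) = c i) :
    (1 + (1 / 2) * ∑ s ∈ S, w s *
      (Real.sqrt (∏ i ∈ m s, t i) / Real.sqrt (∑ s ∈ S, (∏ i ∈ m s, t i) * w s) - 1) ^ 2)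
      * ∏ i, t i ^ c i ≤ ∑ s ∈ S, (∏ i ∈ m s, t i) * w s := by
  have hpos : ∀ s, 0 < ∏ i ∈ m s, t i := fun s => Finset.prod_pos fun i _ => ht i
  set D := ∑ s ∈ S, (∏ i ∈ m s, t i) * w s with hD
  have hD0 : 0 ≤ D := Finset.sum_nonneg fun s hs => mul_nonneg (hpos s).le (hw s hs)
  set T := Real.sqrt D with hT
  have hTD : T ^ 2 = D := Real.sq_sqrt hD0
  set A := ∑ s ∈ S, w s * Real.sqrt (∏ i ∈ m s, t i) with hA
  set P := Real.exp (∑ i, c i * (Real.log (t i) / 2)) with hP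
  have hPP : ∏ i, t i ^ c i = P ^ 2 := by
    rw [hP, ← Real.exp_nat_mul, Finset.mul_sum, Real.exp_sum]
    refine Finset.prod_congr rfl fun i _ => ?_
    rw [Real.rpow_def_of_pos (ht i)]
    congr 1
    push_cast
    ring
  have hsq : ∀ s, Real.sqrt (∏ i ∈ m s, t i) = Real.exp (∑ i ∈ m s, Real.log (t i) / 2) := by
    intro s
    rw [Real.sqrt_eq_iff_mul_self_eq (hpos s).le (Real.exp_pos _).le, ← Real.exp_add,
      ← Finset.sum_add_distrib, Real.exp_sum]
    refine Finset.prod_congr rfl fun i _ => ?_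
    rw [add_halves, Real.exp_log (ht i)]
  have hPA : P ≤ A := by
    have := convexOn_exp.map_sum_le (t := S) (w := w)
      (p := fun s => ∑ i ∈ m s, Real.log (t i) / 2) hw hw1 (fun _ _ => Set.mem_univ _)
    simp only [smul_eq_mul, ← hsq] at this
    refine le_trans (le_of_eq ?_) this
    rw [hP]
    congr 1
    have e : ∀ s ∈ S, w s * ∑ i ∈ m s, Real.log (t i) / 2 =
        ∑ i, (if i ∈ m s then w s else 0) * (Real.log (t i) / 2) := by
      intro s _
      simp [Finset.mul_sum, ite_mul]
    rw [Finset.sum_congr rfl e, Finset.sum_comm]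
    refine Finset.sum_congr rfl fun i _ => ?_
    rw [← Finset.sum_mul, hm]
  have hP0 : 0 < P := Real.exp_pos _
  have hwt : ∑ s ∈ S, w s * Real.sqrt (∏ i ∈ m s, t i) ^ 2 = D := by
    rw [hD]
    refine Finset.sum_congr rfl fun s _ => ?_
    rw [Real.sq_sqrt (hpos s).le, mul_comm]
  have hAT : A ≤ T := by
    apply Real.le_sqrt_of_sq_le
    have h0 : 0 ≤ ∑ s ∈ S, w s * (Real.sqrt (∏ i ∈ m s, t i) - A) ^ 2 :=
      Finset.sum_nonneg fun s hs => mul_nonneg (hw s hs) (sq_nonneg _)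
    have h1 : ∑ s ∈ S, w s * (Real.sqrt (∏ i ∈ m s, t i) - A) ^ 2 =
        ∑ s ∈ S, w s * Real.sqrt (∏ i ∈ m s, t i) ^ 2
          - 2 * A * (∑ s ∈ S, w s * Real.sqrt (∏ i ∈ m s, t i)) + A ^ 2 * ∑ s ∈ S, w s := by
      generalize A = B
      rw [Finset.mul_sum, Finset.mul_sum, ← Finset.sum_sub_distrib, ← Finset.sum_add_distrib]
      exact Finset.sum_congr rfl fun s _ => by ring
    rw [hwt, hw1, ← hA] at h1
    nlinarith
  have hT0 : 0 < T := by linarith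
  have hth : ∑ s ∈ S, w s * (Real.sqrt (∏ i ∈ m s, t i) / T - 1) ^ 2 = 2 - 2 * (A / T) := by
    have h1 : ∑ s ∈ S, w s * (Real.sqrt (∏ i ∈ m s, t i) / T - 1) ^ 2 =
        (∑ s ∈ S, w s * Real.sqrt (∏ i ∈ m s, t i) ^ 2) / T ^ 2
          - 2 / T * (∑ s ∈ S, w s * Real.sqrt (∏ i ∈ m s, t i)) + ∑ s ∈ S, w s := by
      rw [Finset.sum_div, Finset.mul_sum, ← Finset.sum_sub_distrib, ← Finset.sum_add_distrib]
      exact Finset.sum_congr rfl fun s _ => by ring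
    rw [h1, hwt, hw1, ← hA, hTD, div_self (by rw [← hTD]; positivity)]
    ring
  rw [hth, hPP, ← hTD]
  exact final_ineq A T P hP0 hPA hAT

theorem ball_barthe_stability
    (n k : ℕ) (hn : 1 ≤ n) (hk : n + 1 ≤ k)
    (t c : Fin k → ℝ) (ht : ∀ i, 0 < t i) (hc : ∀ i, 0 < c i)
    (u : Fin k → EuclideanSpace ℝ (Fin n)) (hu : ∀ i, ‖u i‖ = 1)
    (hiso : ∀ x : EuclideanSpace ℝ (Fin n), ‖x‖ ^ 2 = ∑ i, c i * ⟪u i, x⟫ ^ 2) :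
    thetaStar n k t c u * ∏ i, t i ^ c i ≤
      Matrix.det (Matrix.of fun (r q : Fin n) => ∑ i, t i * c i * u i r * u i q) := by
  have hcb := fun a : Fin k → ℝ => cauchy_binet n k (fun i => a i * c i) u
  have hM := iso_matrix n k c u hiso
  simp only [Finset.prod_mul_distrib] at hcb
  have hone : ∑ s ∈ (Finset.powersetCard n (Finset.univ : Finset (Fin k))).attach,
      (∏ i ∈ s.1, c i) * subDetSq n k u s.1 (Finset.mem_powersetCard.mp s.2).2 = 1 := by
    have h := hcb (fun _ => 1)
    simp only [one_mul, Finset.prod_const_one, hM] at h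
    rw [← h]
    exact Matrix.det_one
  have hmarg : ∀ j, ∑ s ∈ (Finset.powersetCard n (Finset.univ : Finset (Fin k))).attach,
      (if j ∈ s.1 then
        (∏ i ∈ s.1, c i) * subDetSq n k u s.1 (Finset.mem_powersetCard.mp s.2).2 else 0)
        = c j := by
    intro j
    have h := hcb (fun i => if i = j then 2 else 1)
    have e1 : (Matrix.of fun (r q : Fin n) =>
        ∑ i, (if i = j then (2 : ℝ) else 1) * c i * u i r * u i q) =
        1 + Matrix.replicateCol Unit (fun r => c j * u j r)
          * Matrix.replicateRow Unit (fun q => u j q) := by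
      ext r q
      rw [Matrix.add_apply, ← hM r q]
      have : ∀ i, (if i = j then (2 : ℝ) else 1) * c i * u i r * u i q =
          c i * u i r * u i q + (if i = j then c i * u i r * u i q else 0) := by
        intro i
        split_ifs <;> ring
      rw [Matrix.of_apply, Finset.sum_congr rfl fun i _ => this i, Finset.sum_add_distrib]
      simp [Matrix.mul_apply]
    rw [e1, Matrix.det_one_add_replicateCol_mul_replicateRow] at h
    have e2 : (fun q => u j q) ⬝ᵥ (fun r => c j * u j r) = c j := by
      have hn1 : ∑ r, u j r ^ 2 = 1 := by
        have := EuclideanSpace.real_norm_sq_eq (u j)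
        rw [hu] at this
        linarith
      calc (fun q => u j q) ⬝ᵥ (fun r => c j * u j r) = c j * ∑ r, u j r ^ 2 := by
            rw [dotProduct, Finset.mul_sum]
            exact Finset.sum_congr rfl fun r _ => by ring
        _ = c j := by rw [hn1, mul_one]
    rw [e2] at h
    have e3 : ∀ s ∈ (Finset.powersetCard n (Finset.univ : Finset (Fin k))).attach,
        (∏ i ∈ s.1, if i = j then (2 : ℝ) else 1) * (∏ i ∈ s.1, c i) *
          subDetSq n k u s.1 (Finset.mem_powersetCard.mp s.2).2 =
        (∏ i ∈ s.1, c i) * subDetSq n k u s.1 (Finset.mem_powersetCard.mp s.2).2 +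
        (if j ∈ s.1 then
        (∏ i ∈ s.1, c i) * subDetSq n k u s.1 (Finset.mem_powersetCard.mp s.2).2 else 0) := by
      intro s _
      rw [Finset.prod_ite_eq']
      split_ifs <;> ring
    rw [Finset.sum_congr rfl e3, Finset.sum_add_distrib, hone] at h
    linarith
  have hfin := weighted_ineq (Finset.powersetCard n (Finset.univ : Finset (Fin k))).attach
    (fun s => s.1)
    (fun s => (∏ i ∈ s.1, c i) * subDetSq n k u s.1 (Finset.mem_powersetCard.mp s.2).2)
    (fun s _ => mul_nonneg (Finset.prod_nonneg fun i _ => (hc i).le) (sq_nonneg _))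
    hone t c ht hmarg
  rw [hcb t]
  unfold thetaStar tZero
  simpa only [mul_assoc] using hfin

end
end

section
/- Let k ≥ n+1, let t_1,…,t_k > 0, c_1,…,c_k > 0 and u_1,…,u_k ∈ S^{n−1} satisfy Σ_{i=1}^k c_i u_i⊗u_i = Id_n, and suppose there exist β > 0 and indices {i_1,…,i_{n+1}} ⊆ {1,…,k} such that c_{i_1}⋯c_{i_n}·det[u_{i_1},…,u_{i_n}]² ≥ β and c_{i_2}⋯c_{i_{n+1}}·det[u_{i_2},…,u_{i_{n+1}}]² ≥ β. Then det(Σ_{i=1}^k t_i c_i u_i⊗u_i) ≥ (1 + β(t_{i_1} − t_{i_{n+1}})²/(4(t_{i_1} + t_{i_{n+1}})²)) · Π_{i=1}^k t_i^{c_i}. -/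
open MeasureTheory Metric Set
open scoped RealInnerProductSpace ENNReal

noncomputable section

/-- Cauchy–Binet in symmetrized form (sum over all functions). -/
theorem bb_cauchy_binet (n k : ℕ) (a : Fin k → ℝ) (V : Fin k → Fin n → ℝ) :
    (Nat.factorial n : ℝ) *
      Matrix.det (Matrix.of fun (r q : Fin n) => ∑ i, a i * V i r * V i q) =
    ∑ f : Fin n → Fin k, (∏ j, a (f j)) *
      (Matrix.det (Matrix.of fun (r j : Fin n) => V (f j) r)) ^ 2 := by
  set D : (Fin n → Fin k) → ℝ :=
    fun f => Matrix.det (Matrix.of fun (r j : Fin n) => V (f j) r) with hD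
  have hDexp : ∀ f, D f = ∑ σ : Equiv.Perm (Fin n),
      ((Equiv.Perm.sign σ : ℤ) : ℝ) * ∏ j, V (f j) (σ j) := by
    intro f
    simp only [hD, Matrix.det_apply', Matrix.of_apply]
  have hDperm : ∀ (f : Fin n → Fin k) (σ : Equiv.Perm (Fin n)),
      D (f ∘ σ) = ((Equiv.Perm.sign σ : ℤ) : ℝ) * D f := by
    intro f σ
    simp only [hD]
    rw [← Matrix.det_permute']
    rfl
  have hdet : Matrix.det (Matrix.of fun (r q : Fin n) => ∑ i, a i * V i r * V i q) =
      ∑ f : Fin n → Fin k, (∏ j, a (f j)) * (∏ j, V (f j) j) * D f := by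
    simp only [Matrix.det_apply', Matrix.of_apply, Fintype.prod_sum, Finset.mul_sum, hDexp]
    rw [Finset.sum_comm]
    refine Finset.sum_congr rfl fun f _ => Finset.sum_congr rfl fun σ _ => ?_
    rw [Finset.prod_mul_distrib, Finset.prod_mul_distrib]
    ring
  have hsq : ∑ f : Fin n → Fin k, (∏ j, a (f j)) * D f ^ 2 =
      ∑ σ : Equiv.Perm (Fin n), ∑ f : Fin n → Fin k,
        (∏ j, a (f j)) * D f * (((Equiv.Perm.sign σ : ℤ) : ℝ) * ∏ j, V (f j) (σ j)) := by
    rw [Finset.sum_comm]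
    refine Finset.sum_congr rfl fun f _ => ?_
    rw [← Finset.mul_sum, ← hDexp]
    ring
  rw [hsq, hdet]
  have hconst : ∀ σ : Equiv.Perm (Fin n), ∑ f : Fin n → Fin k,
        (∏ j, a (f j)) * D f * (((Equiv.Perm.sign σ : ℤ) : ℝ) * ∏ j, V (f j) (σ j)) =
      ∑ f : Fin n → Fin k, (∏ j, a (f j)) * (∏ j, V (f j) j) * D f := by
    intro σ
    rw [← Equiv.sum_comp (Equiv.arrowCongr σ.symm (Equiv.refl (Fin k)))]
    refine Finset.sum_congr rfl fun f _ => ?_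
    have he : (Equiv.arrowCongr σ.symm (Equiv.refl (Fin k))) f = f ∘ σ := by
      ext x; simp [Equiv.arrowCongr]
    rw [he, hDperm]
    have e1 : ∏ j, a ((f ∘ σ) j) = ∏ j, a (f j) := Equiv.prod_comp σ (fun j => a (f j))
    have e2 : ∏ j, V ((f ∘ σ) j) (σ j) = ∏ j, V (f j) j :=
      Equiv.prod_comp σ (fun j => V (f j) j)
    rw [e1, e2]
    have e3 : ((Equiv.Perm.sign σ : ℤ) : ℝ) * ((Equiv.Perm.sign σ : ℤ) : ℝ) = 1 := by
      rcases Int.units_eq_one_or (Equiv.Perm.sign σ) with h | h <;> simp [h]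
    linear_combination (∏ j, a (f j)) * (∏ j, V (f j) j) * D f * e3
  simp only [hconst]
  simp [Fintype.card_perm]

theorem bb_phi_nonpos (x : ℝ) (hx : 0 < x) : Real.log x - x + 1 ≤ 0 := by
  linarith [Real.log_le_sub_one_of_pos hx]

/-- The two-point gain. -/
theorem bb_two (a b S : ℝ) (ha : 0 < a) (hb : 0 < b) (hS : 0 < S) :
    (Real.log (a / S) - a / S + 1) + (Real.log (b / S) - b / S + 1) ≤
      - ((a - b) ^ 2 / (a + b) ^ 2) := by
  have hm : 0 < (a + b) / 2 / S := by positivity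
  have h1 := bb_phi_nonpos _ hm
  have h2 : Real.log (a / S) + Real.log (b / S) =
      2 * Real.log ((a + b) / 2 / S) + Real.log (4 * a * b / (a + b) ^ 2) := by
    rw [← Real.log_mul (by positivity) (by positivity)]
    have : (2 : ℝ) * Real.log ((a + b) / 2 / S) = Real.log (((a + b) / 2 / S) ^ 2) := by
      rw [Real.log_pow]; norm_num
    rw [this, ← Real.log_mul (by positivity) (by positivity)]
    congr 1
    field_simp
    ring
  have h3 : Real.log (4 * a * b / (a + b) ^ 2) ≤ 4 * a * b / (a + b) ^ 2 - 1 :=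
    Real.log_le_sub_one_of_pos (by positivity)
  have h4 : 4 * a * b / (a + b) ^ 2 - 1 = - ((a - b) ^ 2 / (a + b) ^ 2) := by
    field_simp; ring
  have h5 : a / S + b / S = 2 * ((a + b) / 2 / S) := by field_simp
  linarith

theorem ball_barthe_stability_two_subsets
    (n k : ℕ) (hn : 1 ≤ n) (hk : n + 1 ≤ k)
    (t c : Fin k → ℝ) (ht : ∀ i, 0 < t i) (hc : ∀ i, 0 < c i)
    (u : Fin k → EuclideanSpace ℝ (Fin n)) (hu : ∀ i, ‖u i‖ = 1)
    (hiso : ∀ x : EuclideanSpace ℝ (Fin n), ‖x‖ ^ 2 = ∑ i, c i * ⟪u i, x⟫ ^ 2)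
    (β : ℝ) (hβ : 0 < β) (idx : Fin (n + 1) → Fin k) (hidx : StrictMono idx)
    (h1 : β ≤ (∏ j : Fin n, c (idx j.castSucc)) *
      (Matrix.det (Matrix.of fun (r j : Fin n) => u (idx j.castSucc) r)) ^ 2)
    (h2 : β ≤ (∏ j : Fin n, c (idx j.succ)) *
      (Matrix.det (Matrix.of fun (r j : Fin n) => u (idx j.succ) r)) ^ 2) :
    (1 + β * (t (idx 0) - t (idx (Fin.last n))) ^ 2 /
        (4 * (t (idx 0) + t (idx (Fin.last n))) ^ 2)) * ∏ i, t i ^ c i ≤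
      Matrix.det (Matrix.of fun (r q : Fin n) => ∑ i, t i * c i * u i r * u i q) := by
  classical
  have hN : (0 : ℝ) < (Nat.factorial n : ℝ) := by exact_mod_cast Nat.factorial_pos n
  set N : ℝ := (Nat.factorial n : ℝ) with hNdef
  set W : (Fin n → Fin k) → ℝ := fun f => (∏ j, c (f j)) *
      (Matrix.det (Matrix.of fun (r j : Fin n) => u (f j) r)) ^ 2 with hW
  have hW0 : ∀ f, 0 ≤ W f := fun f =>
    mul_nonneg (Finset.prod_nonneg fun j _ => (hc _).le) (sq_nonneg _)
  have hCB : ∀ s : Fin k → ℝ,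
      N * Matrix.det (Matrix.of fun (r q : Fin n) => ∑ i, s i * c i * u i r * u i q) =
        ∑ f, W f * ∏ j, s (f j) := by
    intro s
    rw [hNdef, bb_cauchy_binet n k (fun i => s i * c i) (fun i r => u i r)]
    refine Finset.sum_congr rfl fun f _ => ?_
    rw [Finset.prod_mul_distrib]
    simp only [hW]
    ring
  -- the isotropy condition, entrywise
  have hinner : ∀ (i : Fin k) (x : EuclideanSpace ℝ (Fin n)), ⟪u i, x⟫ = ∑ r, u i r * x r := by
    intro i x
    simp [PiLp.inner_apply, mul_comm]
  have hpol : ∀ x y : EuclideanSpace ℝ (Fin n), ⟪x, y⟫ = ∑ i, c i * (⟪u i, x⟫ * ⟪u i, y⟫) := by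
    intro x y
    have e1 := hiso (x + y)
    have e2 := hiso x
    have e3 := hiso y
    have e4 := norm_add_sq_real x y
    simp only [inner_add_right] at e1
    have e5 : ∑ i, c i * (⟪u i, x⟫ + ⟪u i, y⟫) ^ 2 = ∑ i, c i * ⟪u i, x⟫ ^ 2 +
        2 * ∑ i, c i * (⟪u i, x⟫ * ⟪u i, y⟫) + ∑ i, c i * ⟪u i, y⟫ ^ 2 := by
      rw [Finset.mul_sum, ← Finset.sum_add_distrib, ← Finset.sum_add_distrib]
      exact Finset.sum_congr rfl fun i _ => by ring
    linarith
  have hid : ∀ r q : Fin n, ∑ i, c i * u i r * u i q = (1 : Matrix (Fin n) (Fin n) ℝ) r q := by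
    intro r q
    have := hpol (EuclideanSpace.single r 1) (EuclideanSpace.single q 1)
    simp only [EuclideanSpace.inner_single_right, PiLp.single_apply] at this
    simp only [Matrix.one_apply]
    have h' : ∑ i, c i * u i r * u i q = ∑ i, c i * (u i r * u i q) :=
      Finset.sum_congr rfl fun i _ => by ring
    rw [h']
    simp at this
    rw [← this]
    by_cases h : r = q
    · simp [h]
    · simp [h, Ne.symm h]
  have hsum1 : ∑ f, W f = N := by
    have := hCB (fun _ => 1)
    simp only [one_mul, hid, Finset.prod_const_one, mul_one] at this
    rw [← this]
    have e : (Matrix.of fun r q : Fin n => (1 : Matrix (Fin n) (Fin n) ℝ) r q) = 1 := rfl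
    rw [e, Matrix.det_one, mul_one]
  have hinj : ∀ f, W f ≠ 0 → Function.Injective f := by
    intro f hf a b hab
    by_contra hne
    apply hf
    simp only [hW]
    rw [Matrix.det_zero_of_column_eq hne (fun r => by simp [hab])]
    simp
  have hmiss : ∀ i, ∑ f, W f * (∏ j, if f j = i then (0 : ℝ) else 1) = N * (1 - c i) := by
    intro i
    rw [← hCB (fun l => if l = i then 0 else 1)]
    congr 1
    have e : (Matrix.of fun r q : Fin n =>
        ∑ l, (if l = i then (0 : ℝ) else 1) * c l * u l r * u l q) =
        1 + Matrix.replicateCol Unit (fun r => - (c i) * u i r) *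
          Matrix.replicateRow Unit (fun q => u i q) := by
      ext r q
      have h3 : ∑ l, (if l = i then (0 : ℝ) else 1) * c l * u l r * u l q =
          ∑ l, (c l * u l r * u l q - if l = i then c l * u l r * u l q else 0) :=
        Finset.sum_congr rfl fun l _ => by split_ifs <;> ring
      simp only [Matrix.of_apply, h3, Finset.sum_sub_distrib, hid]
      simp [Matrix.mul_apply]
      ring
    rw [e, Matrix.det_one_add_replicateCol_mul_replicateRow]
    have h4 := real_inner_self_eq_norm_sq (u i)
    rw [hu, hinner] at h4
    simp only [dotProduct]
    have h5 : ∑ r, u i r * (-c i * u i r) = - c i * ∑ r, u i r * u i r := by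
      rw [Finset.mul_sum]
      exact Finset.sum_congr rfl fun r _ => by ring
    rw [h5, h4]; ring
  have hmarg : ∀ i, ∑ f, W f * (∑ j, if f j = i then (1 : ℝ) else 0) = N * c i := by
    intro i
    have key : ∀ f, W f * (∑ j, if f j = i then (1 : ℝ) else 0) =
        W f - W f * (∏ j, if f j = i then (0 : ℝ) else 1) := by
      intro f
      by_cases hf : W f = 0
      · simp [hf]
      have hfi := hinj f hf
      by_cases hex : ∃ j, f j = i
      · obtain ⟨j₀, rfl⟩ := hex
        have e1 : (∑ j, if f j = f j₀ then (1 : ℝ) else 0) = 1 := by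
          simp [hfi.eq_iff]
        have e2 : (∏ j, if f j = f j₀ then (0 : ℝ) else 1) = 0 :=
          Finset.prod_eq_zero (Finset.mem_univ j₀) (by simp)
        rw [e1, e2]; ring
      · push Not at hex
        simp [hex]
    simp only [key, Finset.sum_sub_distrib, hmiss, hsum1]
    ring
  -- main quantities
  set A : (Fin n → Fin k) → ℝ := fun f => ∏ j, t (f j) with hA
  have hA0 : ∀ f, 0 < A f := fun f => Finset.prod_pos fun j _ => ht _
  set S : ℝ := Matrix.det (Matrix.of fun (r q : Fin n) => ∑ i, t i * c i * u i r * u i q) with hS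
  have hNS : N * S = ∑ f, W f * A f := hCB t
  have hSpos : 0 < S := by
    have hpos : 0 < ∑ f, W f * A f := by
      have hge : β * A (fun j => idx j.castSucc) ≤ ∑ f, W f * A f := by
        refine le_trans (mul_le_mul_of_nonneg_right h1 (hA0 _).le) ?_
        exact Finset.single_le_sum (f := fun f => W f * A f)
          (fun f _ => mul_nonneg (hW0 f) (hA0 f).le) (Finset.mem_univ (fun j : Fin n => idx j.castSucc))
      exact lt_of_lt_of_le (mul_pos hβ (hA0 _)) hge
    rw [← hNS] at hpos
    exact (pos_iff_pos_of_mul_pos hpos).1 hN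
  have hlogsum : ∑ f, W f * Real.log (A f) = N * ∑ i, c i * Real.log (t i) := by
    have e1 : ∀ f, W f * Real.log (A f) =
        ∑ i, (W f * (∑ j, if f j = i then (1 : ℝ) else 0)) * Real.log (t i) := by
      intro f
      simp only [hA]
      rw [Real.log_prod (fun j _ => (ht _).ne')]
      simp only [mul_assoc, Finset.sum_mul, ← Finset.mul_sum]
      rw [Finset.sum_comm]
      simp
    simp only [e1]
    rw [Finset.sum_comm]
    simp only [← Finset.sum_mul, hmarg]
    rw [Finset.mul_sum]
    exact Finset.sum_congr rfl fun i _ => by ring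
  set φ : (Fin n → Fin k) → ℝ := fun f => Real.log (A f / S) - A f / S + 1 with hφ
  have hφ0 : ∀ f, φ f ≤ 0 := fun f => bb_phi_nonpos _ (div_pos (hA0 f) hSpos)
  have htot : ∑ f, W f * φ f = N * (∑ i, c i * Real.log (t i) - Real.log S) := by
    have e1 : ∀ f, W f * φ f = W f * Real.log (A f) - W f * Real.log S - W f * A f / S + W f := by
      intro f
      simp only [hφ]
      rw [Real.log_div (hA0 f).ne' hSpos.ne']
      ring
    simp only [e1, Finset.sum_add_distrib, Finset.sum_sub_distrib, ← Finset.sum_mul,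
      ← Finset.sum_div, hlogsum, hsum1, ← hNS]
    field_simp
    ring
  set f1 : Fin n → Fin k := fun j => idx j.castSucc with hf1
  set f2 : Fin n → Fin k := fun j => idx j.succ with hf2
  have hf1i : Function.Injective f1 := hidx.injective.comp (Fin.castSucc_injective n)
  have hf2i : Function.Injective f2 := hidx.injective.comp (Fin.succ_injective n)
  have hWperm : ∀ f (σ : Equiv.Perm (Fin n)), W (f ∘ σ) = W f := by
    intro f σ
    have e1 : ∏ j, c ((f ∘ σ) j) = ∏ j, c (f j) := Equiv.prod_comp σ (fun j => c (f j))
    have e2 : Matrix.det (Matrix.of fun (r j : Fin n) => u ((f ∘ σ) j) r) =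
        ((Equiv.Perm.sign σ : ℤ) : ℝ) * Matrix.det (Matrix.of fun (r j : Fin n) => u (f j) r) := by
      rw [← Matrix.det_permute']; rfl
    simp only [hW]
    rw [e1, e2]
    rcases Int.units_eq_one_or (Equiv.Perm.sign σ) with h | h <;> simp [h]
  have hAperm : ∀ f (σ : Equiv.Perm (Fin n)), A (f ∘ σ) = A f := fun f σ =>
    Equiv.prod_comp σ (fun j => t (f j))
  have hφperm : ∀ f (σ : Equiv.Perm (Fin n)), φ (f ∘ σ) = φ f := by
    intro f σ
    simp only [hφ, hAperm]
  let e : Equiv.Perm (Fin n) ⊕ Equiv.Perm (Fin n) → (Fin n → Fin k) :=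
    Sum.elim (fun σ => f1 ∘ σ) (fun σ => f2 ∘ σ)
  have hdisj : ∀ σ τ : Equiv.Perm (Fin n), f1 ∘ σ ≠ f2 ∘ τ := by
    intro σ τ h
    have h0 := congrFun h (σ.symm ⟨0, hn⟩)
    simp only [Function.comp, Equiv.apply_symm_apply, hf1, hf2] at h0
    have h00 := congrArg Fin.val (hidx.injective h0)
    simp at h00
  have he : Function.Injective e := by
    rintro (σ | σ) (τ | τ) h
    · congr 1; ext x; exact congrArg Fin.val (hf1i (congrFun h x))
    · exact absurd h (hdisj σ τ)
    · exact absurd h.symm (hdisj τ σ)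
    · congr 1; ext x; exact congrArg Fin.val (hf2i (congrFun h x))
  have hsub : ∑ f, W f * φ f ≤ N * (W f1 * φ f1 + W f2 * φ f2) := by
    have s1 : ∑ f, W f * φ f ≤ ∑ f ∈ Finset.univ.image e, W f * φ f := by
      have := Finset.sum_le_sum_of_subset_of_nonneg (f := fun f => - (W f * φ f))
        (Finset.subset_univ (Finset.univ.image e))
        (fun f _ _ => by nlinarith [hW0 f, hφ0 f, mul_nonneg (hW0 f) (neg_nonneg.2 (hφ0 f))])
      simp only [Finset.sum_neg_distrib] at this
      linarith
    rw [Finset.sum_image (fun x _ y _ h => he h), Fintype.sum_sum_type] at s1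
    simp only [e, Sum.elim_inl, Sum.elim_inr, hWperm, hφperm, Finset.sum_const,
      Finset.card_univ, Fintype.card_perm, Fintype.card_fin, nsmul_eq_mul] at s1
    rw [mul_add]
    exact s1
  set t0 := t (idx 0) with ht0
  set tl := t (idx (Fin.last n)) with htl
  have p0 : 0 < t0 := ht _
  have pl : 0 < tl := ht _
  have hab : A f1 * tl = t0 * A f2 := by
    have e1 := Fin.prod_univ_castSucc (fun j => t (idx j))
    have e2 := Fin.prod_univ_succ (fun j => t (idx j))
    simp only [hA, hf1, hf2]
    rw [← e1, e2]
  set x : ℝ := (t0 - tl) ^ 2 / (t0 + tl) ^ 2 with hx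
  have hx0 : 0 ≤ x := by positivity
  have htwo : φ f1 + φ f2 ≤ - x := by
    have := bb_two (A f1) (A f2) S (hA0 _) (hA0 _) hSpos
    have e1 : A f1 = t0 * (A f2 / tl) := by field_simp; linarith
    have e2 : A f2 = tl * (A f2 / tl) := by field_simp
    have hq : 0 < A f2 / tl := div_pos (hA0 _) pl
    have e3 : (A f1 - A f2) ^ 2 / (A f1 + A f2) ^ 2 = x := by
      rw [e1]
      generalize A f2 / tl = q at *
      rw [e2, hx, ← sub_mul, ← add_mul, mul_pow, mul_pow, mul_div_mul_right _ _ (by positivity)]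
    rw [e3] at this
    exact this
  have hlog : ∑ i, c i * Real.log (t i) + β * x ≤ Real.log S := by
    have q1 : W f1 * φ f1 ≤ β * φ f1 := mul_le_mul_of_nonpos_right h1 (hφ0 _)
    have q2 : W f2 * φ f2 ≤ β * φ f2 := mul_le_mul_of_nonpos_right h2 (hφ0 _)
    have q3 := mul_le_mul_of_nonneg_left htwo hβ.le
    rw [htot] at hsub
    have q4 := le_of_mul_le_mul_left hsub hN
    linarith
  have hP : ∏ i, t i ^ c i = Real.exp (∑ i, c i * Real.log (t i)) := by
    rw [Real.exp_sum]
    exact Finset.prod_congr rfl fun i _ => by rw [Real.rpow_def_of_pos (ht i), mul_comm]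
  rw [hP]
  have hfin : β * (t0 - tl) ^ 2 / (4 * (t0 + tl) ^ 2) ≤ β * x := by
    have : β * (t0 - tl) ^ 2 / (4 * (t0 + tl) ^ 2) = β * x / 4 := by
      rw [hx]; field_simp
    rw [this]
    linarith [mul_nonneg hβ.le hx0]
  calc _ ≤ Real.exp (β * x) * Real.exp (∑ i, c i * Real.log (t i)) := by
        refine mul_le_mul_of_nonneg_right ?_ (Real.exp_pos _).le
        linarith [Real.add_one_le_exp (β * x)]
    _ = Real.exp (∑ i, c i * Real.log (t i) + β * x) := by rw [← Real.exp_add, add_comm]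
    _ ≤ Real.exp (Real.log S) := Real.exp_le_exp.2 hlog
    _ = S := Real.exp_log hSpos

end
end

section
/- Let S be a regular simplex in ℝ^n whose centroid is the origin, and let M_1 ⊆ S and M_2 ⊇ S be convex bodies. Let ε ∈ (0,1). (i) If (1−ε)S is not contained in M_1, then V(S∖M_1) ≥ (n/(n+1))^n ε^n V(S) > (1/e) ε^n V(S). (ii) If M_2 is not contained in (1+ε)S, then V(M_2∖S) ≥ (ε/(n+1)) V(S). -/
open MeasureTheory Metric Set
open scoped RealInnerProductSpace ENNReal Pointwise
noncomputable section

/-- One-dimensional Brunn-Minkowski for compact sets. -/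
lemma bm_compact {K L C : Set ℝ} (hK : IsCompact K) (hL : IsCompact L) (hKn : K.Nonempty)
    (hLn : L.Nonempty) (hC : ∀ x ∈ K, ∀ y ∈ L, x + y ∈ C) :
    volume K + volume L ≤ volume C := by
  obtain ⟨k, hk, hkm⟩ := hK.exists_isGreatest hKn
  obtain ⟨l, hl, hlm⟩ := hL.exists_isLeast hLn
  have h1 : volume ((fun x => l + x) '' K) = volume K := by
    rw [Set.image_add_left, measure_preimage_add]
  have h2 : volume ((fun x => k + x) '' L) = volume L := by
    rw [Set.image_add_left, measure_preimage_add]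
  rw [← h1, ← h2]
  have hmeas : MeasurableSet ((fun x => k + x) '' L) :=
    (hL.image (by fun_prop)).measurableSet
  have hd : AEDisjoint volume ((fun x => l + x) '' K) ((fun x => k + x) '' L) := by
    refine measure_mono_null (t := {k + l}) ?_ (by simp)
    rintro z ⟨⟨x, hx, rfl⟩, ⟨y, hy, hxy⟩⟩
    have a := hkm hx
    have b := hlm hy
    simp only [mem_singleton_iff] at *
    linarith
  rw [← measure_union₀ hmeas.nullMeasurableSet hd]
  apply measure_mono
  rintro z (⟨x, hx, rfl⟩ | ⟨y, hy, rfl⟩)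
  · show l + x ∈ C
    rw [add_comm]; exact hC _ hx _ hl
  · exact hC _ hk _ hy

lemma bm_meas {A B C : Set ℝ} (hA : MeasurableSet A) (hB : MeasurableSet B) (hAn : A.Nonempty)
    (hBn : B.Nonempty) (hC : ∀ x ∈ A, ∀ y ∈ B, x + y ∈ C) :
    volume A + volume B ≤ volume C := by
  obtain ⟨a, ha⟩ := hAn
  obtain ⟨b, hb⟩ := hBn
  rw [hA.measure_eq_iSup_isCompact, hB.measure_eq_iSup_isCompact]
  have key : ∀ K ⊆ A, IsCompact K → ∀ L ⊆ B, IsCompact L → volume K + volume L ≤ volume C := by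
    intro K hKA hK L hLB hL
    refine le_trans (add_le_add (measure_mono (subset_insert a K)) (measure_mono (subset_insert b L)))
      (bm_compact (hK.insert a) (hL.insert b) (insert_nonempty _ _) (insert_nonempty _ _) ?_)
    intro x hx y hy
    exact hC x (insert_subset ha hKA hx) y (insert_subset hb hLB hy)
  simp_rw [iSup_and']
  refine ENNReal.biSup_add_biSup_le' ⟨∅, by simp⟩ ⟨∅, by simp⟩ ?_
  rintro K ⟨hK1, hK2⟩ L ⟨hL1, hL2⟩
  exact key K hK1 hK2 L hL1 hL2

lemma bm_one {A B C : Set ℝ} (hA : MeasurableSet A) (hB : MeasurableSet B) (hAn : A.Nonempty)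
    (hBn : B.Nonempty) {s t : ℝ} (hs : 0 < s) (ht : 0 < t)
    (hC : ∀ x ∈ A, ∀ y ∈ B, s * x + t * y ∈ C) :
    ENNReal.ofReal s * volume A + ENNReal.ofReal t * volume B ≤ volume C := by
  have h1 : volume (s • A) = ENNReal.ofReal s * volume A := by
    rw [Measure.addHaar_smul]; simp [abs_of_pos hs]
  have h2 : volume (t • B) = ENNReal.ofReal t * volume B := by
    rw [Measure.addHaar_smul]; simp [abs_of_pos ht]
  rw [← h1, ← h2]
  refine bm_meas (hA.const_smul₀ s) (hB.const_smul₀ t) hAn.smul_set hBn.smul_set ?_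
  rintro _ ⟨x, hx, rfl⟩ _ ⟨y, hy, rfl⟩
  exact hC x hx y hy

lemma layer {u : ℝ → ℝ≥0∞} (hu : Measurable u) (hf : ∀ x, u x ≠ ∞) :
    ∫⁻ x, u x = ∫⁻ r in Ioi (0:ℝ), volume {x | ENNReal.ofReal r < u x} := by
  have h := lintegral_eq_lintegral_meas_lt (volume : Measure ℝ) (f := fun x => (u x).toReal)
    (Filter.Eventually.of_forall fun x => ENNReal.toReal_nonneg) hu.ennreal_toReal.aemeasurable
  simp only [ENNReal.ofReal_toReal (hf _)] at h
  rw [h]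
  refine setLIntegral_congr_fun measurableSet_Ioi ?_
  intro r hr
  simp only
  congr 1
  ext x
  simp only [mem_ofPred_eq]
  exact (ENNReal.ofReal_lt_iff_lt_toReal (le_of_lt hr) (hf x)).symm

lemma pl_norm {s t : ℝ} (hs : 0 < s) (ht : 0 < t) (hst : s + t = 1) {f g h : ℝ → ℝ≥0∞}
    (hf : Measurable f) (hg : Measurable g) (hh : Measurable h)
    (hf1 : ⨆ x, f x = 1) (hg1 : ⨆ x, g x = 1)
    (H : ∀ x y, f x ^ s * g y ^ t ≤ h (s * x + t * y)) :
    ENNReal.ofReal s * (∫⁻ x, f x) + ENNReal.ofReal t * (∫⁻ x, g x) ≤ ∫⁻ x, h x := by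
  have hfle : ∀ x, f x ≤ 1 := fun x => hf1 ▸ le_iSup f x
  have hgle : ∀ x, g x ≤ 1 := fun x => hg1 ▸ le_iSup g x
  have hh' : Measurable (fun x => min (h x) 1) := hh.min measurable_const
  refine le_trans ?_ (lintegral_mono (fun x => min_le_left (h x) 1))
  rw [layer hf (fun x => ((hfle x).trans_lt ENNReal.one_lt_top).ne),
    layer hg (fun x => ((hgle x).trans_lt ENNReal.one_lt_top).ne),
    layer hh' (fun x => ((min_le_right _ _).trans_lt ENNReal.one_lt_top).ne)]
  have anti : ∀ u : ℝ → ℝ≥0∞, Measurable fun r : ℝ => volume {x | ENNReal.ofReal r < u x} := by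
    intro u
    refine Antitone.measurable ?_
    intro a b hab
    refine measure_mono ?_
    intro x hx
    exact lt_of_le_of_lt (ENNReal.ofReal_le_ofReal hab) hx
  rw [← lintegral_const_mul _ (anti f), ← lintegral_const_mul _ (anti g),
    ← lintegral_add_left ((anti f).const_mul _)]
  refine lintegral_mono ?_
  intro r
  simp only
  rcases lt_or_ge (ENNReal.ofReal r) 1 with h1 | h1
  · have hA : {x | ENNReal.ofReal r < f x}.Nonempty := by
      rw [← hf1] at h1; exact lt_iSup_iff.1 h1
    have hB : {x | ENNReal.ofReal r < g x}.Nonempty := by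
      rw [← hg1] at h1; exact lt_iSup_iff.1 h1
    refine bm_one (measurableSet_lt measurable_const hf) (measurableSet_lt measurable_const hg)
      hA hB hs ht ?_
    intro x hx y hy
    refine lt_min (lt_of_lt_of_le ?_ (H x y)) h1
    have e : ENNReal.ofReal r = ENNReal.ofReal r ^ s * ENNReal.ofReal r ^ t := by
      rw [← ENNReal.rpow_add_of_nonneg _ _ hs.le ht.le, hst, ENNReal.rpow_one]
    rw [e]
    exact ENNReal.mul_lt_mul (ENNReal.rpow_lt_rpow hx hs) (ENNReal.rpow_lt_rpow hy ht)
  · have hA : {x | ENNReal.ofReal r < f x} = ∅ := by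
      ext x; simpa using (hfle x).trans h1
    have hB : {x | ENNReal.ofReal r < g x} = ∅ := by
      ext x; simpa using (hgle x).trans h1
    simp [hA, hB]

lemma amgm {s t : ℝ} (hs : 0 < s) (ht : 0 < t) (hst : s + t = 1) (a b : ℝ≥0∞) :
    a ^ s * b ^ t ≤ ENNReal.ofReal s * a + ENNReal.ofReal t * b := by
  have hpq : (s⁻¹).HolderConjugate t⁻¹ := by
    rw [Real.holderConjugate_iff]
    refine ⟨(one_lt_inv₀ hs).2 (by linarith), by simpa using hst⟩
  have := ENNReal.young_inequality (a ^ s) (b ^ t) hpq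
  rw [← ENNReal.rpow_mul, ← ENNReal.rpow_mul, mul_inv_cancel₀ hs.ne', mul_inv_cancel₀ ht.ne',
    ENNReal.rpow_one, ENNReal.rpow_one, ENNReal.ofReal_inv_of_pos hs, ENNReal.ofReal_inv_of_pos ht,
    div_eq_mul_inv, div_eq_mul_inv, inv_inv, inv_inv, mul_comm a, mul_comm b] at this
  exact this

lemma pl_bdd {s t : ℝ} (hs : 0 < s) (ht : 0 < t) (hst : s + t = 1) {f g h : ℝ → ℝ≥0∞}
    (hf : Measurable f) (hg : Measurable g) (hh : Measurable h)
    (hfb : ⨆ x, f x ≠ ∞) (hgb : ⨆ x, g x ≠ ∞)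
    (H : ∀ x y, f x ^ s * g y ^ t ≤ h (s * x + t * y)) :
    (∫⁻ x, f x) ^ s * (∫⁻ x, g x) ^ t ≤ ∫⁻ x, h x := by
  rcases eq_or_ne (⨆ x, f x) 0 with h0 | ha0
  · have : ∀ x, f x = 0 := by simpa using h0
    simp [this, ENNReal.zero_rpow_of_pos hs]
  rcases eq_or_ne (⨆ x, g x) 0 with h0 | hb0
  · have : ∀ x, g x = 0 := by simpa using h0
    simp [this, ENNReal.zero_rpow_of_pos ht]
  set a := ⨆ x, f x
  set b := ⨆ x, g x
  have hk0 : (a⁻¹) ^ s * (b⁻¹) ^ t ≠ 0 := by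
    simp [ENNReal.rpow_eq_zero_iff, hfb, hgb, hs, ht, hs.not_gt, ht.not_gt]
  have hk1 : (a⁻¹) ^ s * (b⁻¹) ^ t ≠ ∞ := by
    refine ENNReal.mul_ne_top (ENNReal.rpow_ne_top_of_nonneg hs.le (by simpa using ha0))
      (ENNReal.rpow_ne_top_of_nonneg ht.le (by simpa using hb0))
  have key := pl_norm hs ht hst (f := fun x => a⁻¹ * f x) (g := fun x => b⁻¹ * g x)
    (h := fun x => ((a⁻¹) ^ s * (b⁻¹) ^ t) * h x) (hf.const_mul _) (hg.const_mul _) (hh.const_mul _)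
    (by rw [← ENNReal.mul_iSup]; exact ENNReal.inv_mul_cancel ha0 hfb)
    (by rw [← ENNReal.mul_iSup]; exact ENNReal.inv_mul_cancel hb0 hgb)
    (by
      intro x y
      rw [ENNReal.mul_rpow_of_nonneg _ _ hs.le, ENNReal.mul_rpow_of_nonneg _ _ ht.le,
        mul_mul_mul_comm]
      exact mul_le_mul_right (H x y) _)
  have key2 := (amgm hs ht hst _ _).trans key
  rw [lintegral_const_mul _ hf, lintegral_const_mul _ hg, lintegral_const_mul _ hh,
    ENNReal.mul_rpow_of_nonneg _ _ hs.le, ENNReal.mul_rpow_of_nonneg _ _ ht.le,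
        mul_mul_mul_comm] at key2
  exact (ENNReal.mul_le_mul_iff_right hk0 hk1).1 key2

/-- The Prekopa-Leindler property of a measure space with linear structure. -/
def PL (E : Type) [AddCommGroup E] [Module ℝ E] [MeasurableSpace E] (μ : Measure E) : Prop :=
  ∀ s t : ℝ, 0 < s → 0 < t → s + t = 1 → ∀ f g h : E → ℝ≥0∞, Measurable f → Measurable g →
    Measurable h → (∀ x y, f x ^ s * g y ^ t ≤ h (s • x + t • y)) →
    (∫⁻ x, f x ∂μ) ^ s * (∫⁻ x, g x ∂μ) ^ t ≤ ∫⁻ x, h x ∂μ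

lemma pl_real : PL ℝ volume := by
  intro s t hs ht hst f g h hf hg hh H
  have lim : ∀ u : ℝ → ℝ≥0∞, Measurable u →
      Filter.Tendsto (fun N : ℕ => ∫⁻ x, min (u x) N) Filter.atTop (nhds (∫⁻ x, u x)) := by
    intro u hu
    refine lintegral_tendsto_of_tendsto_of_monotone (fun N => (hu.min measurable_const).aemeasurable)
      (Filter.Eventually.of_forall fun x N M hNM => ?_) (Filter.Eventually.of_forall fun x => ?_)
    · exact min_le_min_left _ (by exact_mod_cast hNM)
    · have := (tendsto_const_nhds (x := u x) (f := Filter.atTop)).min ENNReal.tendsto_nat_nhds_top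
      simpa using this
  have bd : ∀ N : ℕ, (∫⁻ x, min (f x) N) ^ s * (∫⁻ x, min (g x) N) ^ t ≤ ∫⁻ x, h x := by
    intro N
    refine pl_bdd hs ht hst (hf.min measurable_const) (hg.min measurable_const) hh
      (ne_top_of_le_ne_top (ENNReal.natCast_ne_top N) (iSup_le fun x => min_le_right _ _))
      (ne_top_of_le_ne_top (ENNReal.natCast_ne_top N) (iSup_le fun x => min_le_right _ _)) ?_
    intro x y
    refine le_trans ?_ (H x y)
    gcongr <;> exact min_le_left _ _
  -- pass to the limit in each factor through suprema
  have sup : ∀ u : ℝ → ℝ≥0∞, Measurable u → ∀ r : ℝ, 0 < r →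
      (∫⁻ x, u x) ^ r = ⨆ N : ℕ, (∫⁻ x, min (u x) N) ^ r := by
    intro u hu r hr
    refine tendsto_nhds_unique ((ENNReal.continuous_rpow_const.tendsto _).comp (lim u hu)) ?_
    refine tendsto_atTop_iSup ?_
    intro N M hNM
    refine ENNReal.rpow_le_rpow (lintegral_mono fun x => ?_) hr.le
    exact min_le_min_left _ (by exact_mod_cast hNM)
  rw [sup f hf s hs, sup g hg t ht]
  rw [ENNReal.iSup_mul]
  refine iSup_le fun N => ?_
  rw [ENNReal.mul_iSup]
  refine iSup_le fun M => le_trans ?_ (bd (max N M))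
  have : ((N : ℝ≥0∞)) ≤ (max N M : ℕ) := by exact_mod_cast le_max_left _ _
  have : ((M : ℝ≥0∞)) ≤ (max N M : ℕ) := by exact_mod_cast le_max_right _ _
  gcongr

lemma PL.prod {E F : Type} [AddCommGroup E] [Module ℝ E] [MeasurableSpace E] {μ : Measure E}
    [AddCommGroup F] [Module ℝ F] [MeasurableSpace F] {ν : Measure F} [SFinite μ] [SFinite ν]
    (h1 : PL E μ) (h2 : PL F ν) : PL (E × F) (μ.prod ν) := by
  intro s t hs ht hst f g h hf hg hh H
  rw [lintegral_prod _ hf.aemeasurable, lintegral_prod _ hg.aemeasurable,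
    lintegral_prod _ hh.aemeasurable]
  refine h1 s t hs ht hst _ _ _ hf.lintegral_prod_right' hg.lintegral_prod_right'
    hh.lintegral_prod_right' ?_
  intro x y
  refine h2 s t hs ht hst _ _ _ (hf.comp measurable_prodMk_left) (hg.comp measurable_prodMk_left)
    (hh.comp measurable_prodMk_left) ?_
  intro x' y'
  exact H (x, x') (y, y')

lemma PL.map {E F : Type} [AddCommGroup E] [Module ℝ E] [MeasurableSpace E] {μ : Measure E}
    [AddCommGroup F] [Module ℝ F] [MeasurableSpace F] {ν : Measure F}
    (h1 : PL E μ) (e : E → F) (he : MeasurePreserving e μ ν)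
    (hl : ∀ (s t : ℝ) x y, e (s • x + t • y) = s • e x + t • e y) : PL F ν := by
  intro s t hs ht hst f g h hf hg hh H
  rw [← he.lintegral_comp hf, ← he.lintegral_comp hg, ← he.lintegral_comp hh]
  refine h1 s t hs ht hst _ _ _ (hf.comp he.measurable) (hg.comp he.measurable)
    (hh.comp he.measurable) ?_
  intro x y
  rw [hl]
  exact H _ _

lemma pl_pi (n : ℕ) : PL (Fin n → ℝ) volume := by
  induction n with
  | zero =>
    intro s t hs ht hst f g h hf hg hh H
    rw [volume_pi, Measure.pi_of_empty]
    simp only [lintegral_dirac]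
    convert H (fun a => isEmptyElim a) (fun a => isEmptyElim a)
  | succ n ih =>
    refine PL.map (pl_real.prod ih) _
      (volume_preserving_piFinSuccAbove (fun _ : Fin (n + 1) => ℝ) 0).symm ?_
    intro s t x y
    ext i
    refine Fin.cases ?_ ?_ i
    · simp [MeasurableEquiv.piFinSuccAbove]
    · intro j; simp [MeasurableEquiv.piFinSuccAbove]

lemma pl_euclid (n : ℕ) : PL (EuclideanSpace ℝ (Fin n)) volume :=
  (pl_pi n).map _ (EuclideanSpace.volume_preserving_symm_measurableEquiv_toLp (Fin n)).symm (by
    intro s t x y; rfl)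


section helpers

variable {n : ℕ}

lemma bm_pt {A C : Set (EuclideanSpace ℝ (Fin n))} {b : EuclideanSpace ℝ (Fin n)}
    {s t : ℝ} (hs : 0 < s) (hC : ∀ x ∈ A, s • x + t • b ∈ C) :
    ENNReal.ofReal (s ^ n) * volume A ≤ volume C := by
  have h : volume ((t • b) +ᵥ (s • A)) = ENNReal.ofReal (s ^ n) * volume A := by
    rw [measure_vadd, Measure.addHaar_smul]; simp [abs_of_pos hs]
  rw [← h]
  refine measure_mono ?_
  rintro _ ⟨_, ⟨x, hx, rfl⟩, rfl⟩
  simp only [vadd_eq_add]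
  rw [add_comm]
  exact hC x hx

lemma bm_pt' (hn : 1 ≤ n) {A C : Set (EuclideanSpace ℝ (Fin n))} {b : EuclideanSpace ℝ (Fin n)}
    (hCf : volume C ≠ ∞)
    {s t : ℝ} (hs : 0 < s) (hC : ∀ x ∈ A, s • x + t • b ∈ C) :
    s * (volume A).toReal ^ (1 / n : ℝ) ≤ (volume C).toReal ^ (1 / n : ℝ) := by
  have h := ENNReal.toReal_mono hCf (bm_pt hs hC)
  rw [ENNReal.toReal_mul, ENNReal.toReal_ofReal (by positivity)] at h
  have h2 := Real.rpow_le_rpow (by positivity) h (show (0:ℝ) ≤ 1 / n by positivity)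
  rw [Real.mul_rpow (by positivity) (by positivity), one_div,
    Real.pow_rpow_inv_natCast hs.le (by omega)] at h2
  simpa using h2

lemma bm_conc (hn : 1 ≤ n) {A B C : Set (EuclideanSpace ℝ (Fin n))}
    (hA : MeasurableSet A) (hB : MeasurableSet B) (hCm : MeasurableSet C)
    (hAn : A.Nonempty) (hBn : B.Nonempty) (hAf : volume A ≠ ∞) (hBf : volume B ≠ ∞)
    (hCf : volume C ≠ ∞)
    {s t : ℝ} (hs : 0 < s) (ht : 0 < t)
    (hC : ∀ x ∈ A, ∀ y ∈ B, s • x + t • y ∈ C) :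
    s * (volume A).toReal ^ (1 / n : ℝ) + t * (volume B).toReal ^ (1 / n : ℝ) ≤
      (volume C).toReal ^ (1 / n : ℝ) := by
  have hn0 : (1 / n : ℝ) ≠ 0 := by positivity
  obtain ⟨a0, ha0⟩ := hAn
  obtain ⟨b0, hb0⟩ := hBn
  rcases eq_or_ne (volume B) 0 with h0 | hB0
  · rw [h0, ENNReal.toReal_zero, Real.zero_rpow hn0, mul_zero, add_zero]
    exact bm_pt' hn hCf hs fun x hx => hC x hx b0 hb0
  rcases eq_or_ne (volume A) 0 with h0 | hA0
  · rw [h0, ENNReal.toReal_zero, Real.zero_rpow hn0, mul_zero, zero_add]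
    refine bm_pt' hn hCf (b := a0) (t := s) ht fun x hx => ?_
    rw [add_comm]; exact hC a0 ha0 x hx
  set α := (volume A).toReal ^ (1 / n : ℝ) with hα
  set β := (volume B).toReal ^ (1 / n : ℝ) with hβ
  have hαp : 0 < α := Real.rpow_pos_of_pos (ENNReal.toReal_pos hA0 hAf) _
  have hβp : 0 < β := Real.rpow_pos_of_pos (ENNReal.toReal_pos hB0 hBf) _
  have hαn : α ^ n = (volume A).toReal := by
    rw [hα, one_div, Real.rpow_inv_natCast_pow ENNReal.toReal_nonneg (by omega)]
  have hβn : β ^ n = (volume B).toReal := by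
    rw [hβ, one_div, Real.rpow_inv_natCast_pow ENNReal.toReal_nonneg (by omega)]
  set m := s * α + t * β with hm
  have hmp : 0 < m := by positivity
  have vol : ∀ (D : Set (EuclideanSpace ℝ (Fin n))) (c : ℝ), 0 < c →
      volume (c⁻¹ • D) = ENNReal.ofReal ((c ^ n)⁻¹) * volume D := by
    intro D c hc
    rw [Measure.addHaar_smul]; simp [abs_of_pos hc]
  have vA : volume (α⁻¹ • A) = 1 := by
    rw [vol A α hαp, ← ENNReal.ofReal_toReal hAf, ← ENNReal.ofReal_mul (by positivity), ← hαn,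
      inv_mul_cancel₀ (by positivity), ENNReal.ofReal_one]
  have vB : volume (β⁻¹ • B) = 1 := by
    rw [vol B β hβp, ← ENNReal.ofReal_toReal hBf, ← ENNReal.ofReal_mul (by positivity), ← hβn,
      inv_mul_cancel₀ (by positivity), ENNReal.ofReal_one]
  have hmA := hA.const_smul₀ (α⁻¹)
  have hmB := hB.const_smul₀ (β⁻¹)
  have hmC := hCm.const_smul₀ (m⁻¹)
  have hs' : 0 < s * α / m := by positivity
  have ht' : 0 < t * β / m := by positivity
  have key := pl_euclid n (s * α / m) (t * β / m) hs' ht'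
    (by rw [← add_div, div_self hmp.ne'])
    ((α⁻¹ • A).indicator 1) ((β⁻¹ • B).indicator 1) ((m⁻¹ • C).indicator 1)
    (measurable_one.indicator hmA) (measurable_one.indicator hmB) (measurable_one.indicator hmC)
    (by
      intro x y
      by_cases hx : x ∈ α⁻¹ • A
      · by_cases hy : y ∈ β⁻¹ • B
        · have : (s * α / m) • x + (t * β / m) • y ∈ m⁻¹ • C := by
            obtain ⟨x, hx, rfl⟩ := hx
            obtain ⟨y, hy, rfl⟩ := hy
            refine ⟨_, hC x hx y hy, ?_⟩
            simp only [smul_add, smul_smul]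
            congr 2
            · field_simp
            · field_simp
          simp [hx, hy, this]
        · simp [hy, ENNReal.zero_rpow_of_pos ht']
      · simp [hx, ENNReal.zero_rpow_of_pos hs'])
  rw [lintegral_indicator_one hmA, lintegral_indicator_one hmB, lintegral_indicator_one hmC, vA, vB,
    ENNReal.one_rpow, ENNReal.one_rpow, one_mul, vol C m hmp, ← ENNReal.ofReal_toReal hCf,
    ← ENNReal.ofReal_mul (by positivity), ENNReal.one_le_ofReal, inv_mul_eq_div,
    one_le_div (by positivity)] at key
  have h2 := Real.rpow_le_rpow (by positivity) key (show (0:ℝ) ≤ 1 / n by positivity)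
  rwa [one_div, Real.pow_rpow_inv_natCast hmp.le (by omega), ← one_div] at h2

/-- Existence of a supporting line for a concave function at an interior point. -/
lemma support_line {I : Set ℝ} {φ : ℝ → ℝ} (h : ConcaveOn ℝ I φ) (h0 : 0 ∈ interior I) :
    ∃ c : ℝ, ∀ t ∈ I, φ t ≤ φ 0 + c * t := by
  have hc : ConvexOn ℝ I (-φ) := h.neg
  refine ⟨-derivWithin (-φ) (Ioi 0) 0, fun t ht => ?_⟩
  rcases lt_trichotomy t 0 with h1 | h1 | h1
  · have a := hc.slope_le_leftDeriv_of_mem_interior ht h0 h1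
    have b := hc.leftDeriv_le_rightDeriv_of_mem_interior h0
    have d := a.trans b
    rw [slope_def_field, div_le_iff₀ (by linarith)] at d
    simp only [Pi.neg_apply] at d
    linarith
  · simp [h1]
  · have a := hc.rightDeriv_le_slope_of_mem_interior h0 ht h1
    rw [slope_def_field, le_div_iff₀ (by linarith)] at a
    simp only [Pi.neg_apply] at a
    linarith


/-- The part of `S` on one side of a hyperplane. -/
def cap (S : Set (EuclideanSpace ℝ (Fin n))) (f : EuclideanSpace ℝ (Fin n) →L[ℝ] ℝ) (t : ℝ) :
    Set (EuclideanSpace ℝ (Fin n)) := {y | y ∈ S ∧ t ≤ f y}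

/-- The `1/n`-th power of the volume of a cap. -/
def capf (S : Set (EuclideanSpace ℝ (Fin n))) (f : EuclideanSpace ℝ (Fin n) →L[ℝ] ℝ) (t : ℝ) : ℝ :=
  (volume (cap S f t)).toReal ^ (1 / n : ℝ)

section
variable {S : Set (EuclideanSpace ℝ (Fin n))} {f : EuclideanSpace ℝ (Fin n) →L[ℝ] ℝ}

lemma cap_closed (hS : IsCompact S) (t : ℝ) : IsClosed (cap S f t) :=
  hS.isClosed.inter (isClosed_le continuous_const f.continuous)

lemma cap_fin (hS : IsCompact S) (t : ℝ) : volume (cap S f t) ≠ ∞ :=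
  ((measure_mono (fun _ hx => hx.1)).trans_lt hS.measure_lt_top).ne

lemma capf_concave (hn : 1 ≤ n) (hS : IsCompact S) (hSc : Convex ℝ S) :
    ConcaveOn ℝ {t | (cap S f t).Nonempty} (capf S f) := by
  have sub : ∀ a b s t : ℝ, 0 ≤ s → 0 ≤ t → s + t = 1 → ∀ x ∈ cap S f a, ∀ y ∈ cap S f b,
      s • x + t • y ∈ cap S f (s • a + t • b) := by
    intro a b s t hs ht hst x hx y hy
    refine ⟨hSc hx.1 hy.1 hs ht hst, ?_⟩
    simp only [map_add, map_smul, smul_eq_mul]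
    exact add_le_add (mul_le_mul_of_nonneg_left hx.2 hs) (mul_le_mul_of_nonneg_left hy.2 ht)
  refine ⟨?_, ?_⟩
  · rintro a ⟨x, hx⟩ b ⟨y, hy⟩ s t hs ht hst
    exact ⟨_, sub a b s t hs ht hst x hx y hy⟩
  · intro a ha b hb s t hs ht hst
    rcases hs.eq_or_lt with rfl | hs
    · obtain rfl : t = 1 := by linarith
      simp
    rcases ht.eq_or_lt with rfl | ht
    · obtain rfl : s = 1 := by linarith
      simp
    exact bm_conc hn (cap_closed hS _).measurableSet (cap_closed hS _).measurableSet
      (cap_closed hS _).measurableSet ha hb (cap_fin hS _) (cap_fin hS _) (cap_fin hS _) hs ht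
      (sub a b s t hs.le ht.le hst)

lemma capf_anti (hS : IsCompact S) : Antitone (capf S f) := by
  intro a b hab
  refine Real.rpow_le_rpow ENNReal.toReal_nonneg (ENNReal.toReal_mono (cap_fin hS _)
    (measure_mono ?_)) (by positivity)
  intro x hx
  exact ⟨hx.1, hab.trans hx.2⟩

lemma capf_nonneg (t : ℝ) : 0 ≤ capf S f t := Real.rpow_nonneg ENNReal.toReal_nonneg _

lemma capf_le (hS : IsCompact S) (t : ℝ) : capf S f t ≤ (volume S).toReal ^ (1 / n : ℝ) :=
  Real.rpow_le_rpow ENNReal.toReal_nonneg (ENNReal.toReal_mono hS.measure_lt_top.ne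
    (measure_mono fun _ hx => hx.1)) (by positivity)

lemma capf_meas (hS : IsCompact S) : Measurable (fun x => capf S f (f x)) :=
  (capf_anti hS).measurable.comp f.continuous.measurable

lemma capf_int (hS : IsCompact S) : IntegrableOn (fun x => capf S f (f x)) S := by
  refine IntegrableOn.of_bound hS.measure_lt_top (capf_meas hS).aestronglyMeasurable
    ((volume S).toReal ^ (1 / n : ℝ)) (Filter.Eventually.of_forall fun x => ?_)
  rw [Real.norm_of_nonneg (capf_nonneg _)]
  exact capf_le hS _

lemma capf_small (hn : 1 ≤ n) (hS : IsCompact S) {r : ℝ} :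
    volume.restrict S {x | capf S f (f x) ≤ r} ≤ ENNReal.ofReal (r ^ n) := by
  have hm : MeasurableSet {x | capf S f (f x) ≤ r} := measurableSet_le (capf_meas hS) measurable_const
  rw [Measure.restrict_apply hm, (hm.inter hS.isClosed.measurableSet).measure_eq_iSup_isCompact]
  refine iSup_le fun K => iSup_le fun hK => iSup_le fun hKc => ?_
  rcases K.eq_empty_or_nonempty with rfl | hne
  · simp
  obtain ⟨x0, hx0, hmin⟩ := hKc.exists_isMinOn hne f.continuous.continuousOn
  have h1 : volume K ≤ volume (cap S f (f x0)) :=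
    measure_mono fun y hy => ⟨(hK hy).2, hmin hy⟩
  refine h1.trans ?_
  have h2 : capf S f (f x0) ≤ r := (hK hx0).1
  rw [← ENNReal.ofReal_toReal (cap_fin hS (f x0))]
  refine ENNReal.ofReal_le_ofReal ?_
  have h3 := pow_le_pow_left₀ (capf_nonneg _) h2 n
  rwa [capf, one_div, Real.rpow_inv_natCast_pow ENNReal.toReal_nonneg (by omega)] at h3

lemma capf_lower (hn : 1 ≤ n) (hS : IsCompact S) :
    (n / (n + 1) : ℝ) * (volume S).toReal ^ (1 / n : ℝ) * (volume S).toReal ≤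
      ∫ x in S, capf S f (f x) := by
  set V := (volume S).toReal with hV
  set W := V ^ (1 / n : ℝ) with hW
  have hV0 : 0 ≤ V := ENNReal.toReal_nonneg
  have hW0 : 0 ≤ W := Real.rpow_nonneg hV0 _
  have hWn : W ^ n = V := by
    rw [hW, one_div, Real.rpow_inv_natCast_pow hV0 (by omega)]
  have hint0 : 0 ≤ ∫ x in S, capf S f (f x) := integral_nonneg fun x => capf_nonneg _
  rw [← ENNReal.ofReal_le_ofReal_iff hint0,
    ofReal_integral_eq_lintegral_ofReal (capf_int hS) (Filter.Eventually.of_forall fun x => capf_nonneg _),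
    lintegral_eq_lintegral_meas_lt _ (Filter.Eventually.of_forall fun x => capf_nonneg _)
      (capf_meas hS).aemeasurable]
  have e : (n / (n + 1) : ℝ) * W * V = ∫ r in Ioc 0 W, (V - r ^ n) := by
    rw [← intervalIntegral.integral_of_le hW0, intervalIntegral.integral_sub (by simp) (by simp)]
    simp only [intervalIntegral.integral_const, integral_pow, sub_zero, smul_eq_mul]
    rw [pow_succ, hWn]
    field_simp
    simp
    ring
  rw [e, ofReal_integral_eq_lintegral_ofReal]
  · refine le_trans ?_ (lintegral_mono_set (Ioc_subset_Ioi_self : Ioc 0 W ⊆ Ioi 0))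
    refine setLIntegral_mono' measurableSet_Ioc ?_
    intro r hr
    rw [ENNReal.ofReal_sub _ (pow_nonneg hr.1.le n), tsub_le_iff_right]
    have h1 : ENNReal.ofReal V = volume.restrict S univ := by
      rw [Measure.restrict_apply_univ, ENNReal.ofReal_toReal hS.measure_lt_top.ne]
    rw [h1]
    calc _ ≤ volume.restrict S ({x | r < capf S f (f x)} ∪ {x | capf S f (f x) ≤ r}) := by
            refine measure_mono fun x _ => ?_
            exact lt_or_ge r (capf S f (f x))
      _ ≤ _ := (measure_union_le _ _).trans (by gcongr; exact capf_small hn hS)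
  · exact (Continuous.integrableOn_Ioc (by fun_prop))
  · refine (ae_restrict_iff' measurableSet_Ioc).2 (Filter.Eventually.of_forall fun r hr => ?_)
    simp only [Pi.zero_apply, sub_nonneg]
    rw [← hWn]
    exact pow_le_pow_left₀ hr.1.le hr.2 n

/-- The Gruenbaum inequality for convex bodies. -/
lemma grunbaum (hn : 1 ≤ n) (hS : IsCompact S) (hSc : Convex ℝ S) (hV : volume S ≠ 0)
    (hint : ∫ x in S, f x = 0) (hpos : ∃ y ∈ S, 0 < f y) :
    (n / (n + 1) : ℝ) ^ n * (volume S).toReal ≤ (volume (cap S f 0)).toReal := by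
  have h0 : (0:ℝ) ∈ interior {t | (cap S f t).Nonempty} := by
    obtain ⟨y, hy, hfy⟩ := hpos
    refine mem_interior.2 ⟨Iio (f y), ?_, isOpen_Iio, hfy⟩
    intro t ht
    exact ⟨y, hy, le_of_lt ht⟩
  obtain ⟨c, hc⟩ := support_line (capf_concave (f := f) hn hS hSc) h0
  have hVp : 0 < (volume S).toReal := ENNReal.toReal_pos hV hS.measure_lt_top.ne
  have hfi : IntegrableOn (fun x => f x) S := f.continuous.continuousOn.integrableOn_compact hS
  have hci : IntegrableOn (fun _ => capf S f 0) S := continuousOn_const.integrableOn_compact hS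
  have up : ∫ x in S, capf S f (f x) ≤ ∫ x in S, (capf S f 0 + c * f x) := by
    refine setIntegral_mono_on (capf_int hS) (hci.add (hfi.const_mul c)) hS.isClosed.measurableSet ?_
    intro x hx
    exact hc _ ⟨x, hx, le_rfl⟩
  rw [integral_add hci (hfi.const_mul c), integral_const_mul, hint, mul_zero, add_zero,
    setIntegral_const, smul_eq_mul] at up
  have lo := (capf_lower (f := f) hn hS).trans up
  rw [mul_comm (Measure.real _ _)] at lo
  have h1 := le_of_mul_le_mul_right lo hVp
  have h2 := pow_le_pow_left₀ (by positivity) h1 n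
  rwa [mul_pow, capf, one_div, Real.rpow_inv_natCast_pow ENNReal.toReal_nonneg (by omega),
    Real.rpow_inv_natCast_pow ENNReal.toReal_nonneg (by omega)] at h2

end


/-- Centered barycentric coordinates of a simplex with centroid at the origin. -/
lemma bary {p : Fin (n + 1) → EuclideanSpace ℝ (Fin n)} (hcent : ∑ i, p i = 0)
    (hint : (interior (convexHull ℝ (range p))).Nonempty) :
    ∃ ℓ : Fin (n + 1) → EuclideanSpace ℝ (Fin n) →ₗ[ℝ] ℝ,
      (convexHull ℝ (range p) = {x | ∀ i, 0 ≤ ℓ i x + 1 / (n + 1)}) ∧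
      (∀ i j, ℓ i (p j) + 1 / (n + 1) = if i = j then 1 else 0) ∧
      (∀ x, ∑ i, (ℓ i x + 1 / (n + 1)) = 1) ∧ (∀ x, ∑ i, (ℓ i x + 1 / (n + 1)) • p i = x) := by
  have htop := interior_convexHull_nonempty_iff_affineSpan_eq_top.1 hint
  have hind : AffineIndependent ℝ p := by
    rw [affineIndependent_iff_finrank_vectorSpan_eq ℝ p (n := n) (by simp)]
    rw [← direction_affineSpan, htop, AffineSubspace.direction_top, finrank_top]
    simp
  let b : AffineBasis (Fin (n + 1)) ℝ (EuclideanSpace ℝ (Fin n)) := ⟨p, hind, htop⟩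
  have hbp : ∀ i, b i = p i := fun i => rfl
  have dec : ∀ i x, b.coord i x = (b.coord i).linear x + b.coord i 0 := by
    intro i x
    have := (b.coord i).map_vadd 0 x
    simpa using this
  have h0 : ∀ i, b.coord i 0 = 1 / (n + 1) := by
    intro i
    have h1 : ∑ j, b.coord i (b j) = 1 := by
      simp [AffineBasis.coord_apply]
    simp_rw [dec i (b _), hbp] at h1
    rw [Finset.sum_add_distrib, ← map_sum, hcent] at h1
    simp at h1
    field_simp
    linarith
  have key : ∀ i x, (b.coord i).linear x + 1 / (n + 1) = b.coord i x := by
    intro i x; rw [dec i x, h0]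
  refine ⟨fun i => (b.coord i).linear, ?_, ?_, ?_, ?_⟩
  · simp only [key]
    exact b.convexHull_eq_nonneg_coord
  · intro i j
    rw [key, ← hbp, b.coord_apply]
  · intro x
    simp only [key, b.sum_coord_apply_eq_one]
  · intro x
    simp only [key]
    exact b.linear_combination_coord_eq_self x

lemma perm_integral {p : Fin (n + 1) → EuclideanSpace ℝ (Fin n)}
    (hV : volume (convexHull ℝ (range p)) ≠ 0) (T : EuclideanSpace ℝ (Fin n) →ₗ[ℝ] EuclideanSpace ℝ (Fin n))
    (σ : Equiv.Perm (Fin (n + 1))) (hT : ∀ i, T (p i) = p (σ i))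
    (f : EuclideanSpace ℝ (Fin n) →L[ℝ] ℝ) :
    ∫ x in convexHull ℝ (range p), f (T x) = ∫ x in convexHull ℝ (range p), f x := by
  have hS : IsCompact (convexHull ℝ (range p)) := (finite_range p).isCompact_convexHull ℝ
  have him : T '' (convexHull ℝ (range p)) = convexHull ℝ (range p) := by
    rw [T.image_convexHull, ← range_comp]
    congr 1
    rw [← σ.surjective.range_comp p]
    congr 1
    ext1 i; exact hT i
  have hdet : |LinearMap.det T| = 1 := by
    have := Measure.addHaar_image_linearMap volume T (convexHull ℝ (range p))
    rw [him] at this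
    have h2 := congrArg ENNReal.toReal this
    rw [ENNReal.toReal_mul, ENNReal.toReal_ofReal (abs_nonneg _)] at h2
    have hVp := ENNReal.toReal_pos hV hS.measure_lt_top.ne
    exact mul_right_cancel₀ hVp.ne' (by linarith)
  have hinj : Function.Injective T := by
    have : LinearMap.det T ≠ 0 := by intro h; rw [h] at hdet; simp at hdet
    exact (LinearMap.equivOfDetNeZero T this).injective
  have := integral_image_eq_integral_abs_det_fderiv_smul volume hS.isClosed.measurableSet
    (f := T) (f' := fun _ => LinearMap.toContinuousLinearMap T)
    (fun x _ => (LinearMap.toContinuousLinearMap T).hasFDerivWithinAt) hinj.injOn (fun x => f x)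
  rw [him] at this
  rw [this]
  simp [ContinuousLinearMap.det, hdet]

lemma centroid_integral {p : Fin (n + 1) → EuclideanSpace ℝ (Fin n)} (hcent : ∑ i, p i = 0)
    (hint : (interior (convexHull ℝ (range p))).Nonempty)
    (f : EuclideanSpace ℝ (Fin n) →L[ℝ] ℝ) :
    ∫ x in convexHull ℝ (range p), f x = 0 := by
  obtain ⟨ℓ, hS, hℓp, hsum, hcomb⟩ := bary hcent hint
  have hSc : IsCompact (convexHull ℝ (range p)) := (finite_range p).isCompact_convexHull ℝ
  have hV : volume (convexHull ℝ (range p)) ≠ 0 := (Measure.measure_pos_of_nonempty_interior _ hint).ne'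
  let T : Fin (n + 1) → EuclideanSpace ℝ (Fin n) →ₗ[ℝ] EuclideanSpace ℝ (Fin n) :=
    fun k => ∑ i, (ℓ i).smulRight (p (i + k))
  have hp : ∀ k, ∑ i, p (i + k) = 0 := by
    intro k
    rw [← hcent]
    exact Equiv.sum_comp (Equiv.addRight k) p
  have hT : ∀ k x, T k x = ∑ i, (ℓ i x + 1 / (n + 1)) • p (i + k) := by
    intro k x
    simp only [T, add_smul, Finset.sum_add_distrib, ← Finset.smul_sum, hp, smul_zero, add_zero]
    simp
  have hTp : ∀ k i, T k (p i) = p (Equiv.addRight k i) := by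
    intro k i
    rw [hT]
    simp only [hℓp]
    simp
  have h1 : ∀ k, ∫ x in convexHull ℝ (range p), f (T k x) = ∫ x in convexHull ℝ (range p), f x :=
    fun k => perm_integral hV (T k) (Equiv.addRight k) (hTp k) f
  have h2 : ∑ k, ∫ x in convexHull ℝ (range p), f (T k x) = 0 := by
    rw [← integral_finsetSum]
    · have : ∀ x, ∑ k, f (T k x) = 0 := by
        intro x
        simp only [hT, map_sum, map_smul]
        rw [Finset.sum_comm]
        refine Finset.sum_eq_zero fun i _ => ?_
        rw [← Finset.smul_sum, ← map_sum]
        have : ∑ k, p (i + k) = 0 := by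
          rw [← hcent]
          exact Equiv.sum_comp (Equiv.addLeft i) p
        rw [this]; simp
      simp [this]
    · intro k _
      have : Continuous (fun x => f (T k x)) :=
        f.continuous.comp (LinearMap.continuous_of_finiteDimensional (T k))
      exact this.continuousOn.integrableOn_compact hSc
  simp only [h1, Finset.sum_const, Finset.card_univ, Fintype.card_fin, nsmul_eq_mul] at h2
  have : ((n + 1 : ℕ) : ℝ) ≠ 0 := by positivity
  exact (mul_eq_zero.1 h2).resolve_left this

lemma exp_bound (hn : 1 ≤ n) : (Real.exp 1)⁻¹ < ((n : ℝ) / (n + 1)) ^ n := by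
  have hn' : (0:ℝ) < n := by exact_mod_cast hn
  have h1 : (1 / n : ℝ) + 1 < Real.exp (1 / n) := Real.add_one_lt_exp (by positivity)
  have h2 := pow_lt_pow_left₀ h1 (by positivity) (n := n) (by omega)
  rw [← Real.exp_nat_mul, mul_one_div_cancel hn'.ne'] at h2
  have h3 : ((n : ℝ) / (n + 1)) ^ n = (((1 / n : ℝ) + 1) ^ n)⁻¹ := by
    rw [← inv_pow]; congr 1; field_simp; ring
  rw [h3]
  exact inv_strictAnti₀ (by positivity) h2

lemma part_one (hn : 1 ≤ n) {p : Fin (n + 1) → EuclideanSpace ℝ (Fin n)} (hcent : ∑ i, p i = 0)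
    (hint : (interior (convexHull ℝ (range p))).Nonempty)
    {M : Set (EuclideanSpace ℝ (Fin n))} (hMc : IsCompact M) (hMconv : Convex ℝ M)
    (hMn : M.Nonempty) {ε : ℝ} (hε0 : 0 < ε) (hε1 : ε < 1)
    (h : ¬ ((1 - ε) • convexHull ℝ (range p) ⊆ M)) :
    ((n : ℝ) / (n + 1)) ^ n * ε ^ n * (volume (convexHull ℝ (range p))).toReal ≤
        (volume (convexHull ℝ (range p) \ M)).toReal := by
  have hSc : IsCompact (convexHull ℝ (range p)) := (finite_range p).isCompact_convexHull ℝ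
  have hV : volume (convexHull ℝ (range p)) ≠ 0 := (Measure.measure_pos_of_nonempty_interior _ hint).ne'
  obtain ⟨ℓ, hS, hℓp, hsum, hcomb⟩ := bary hcent hint
  obtain ⟨i, hi⟩ : ∃ i, (1 - ε) • p i ∉ M := by
    by_contra! hall
    apply h
    rintro _ ⟨x, hx, rfl⟩
    have : convexHull ℝ (range p) ⊆ (fun x => (1 - ε) • x) ⁻¹' M := by
      refine convexHull_min ?_ (hMconv.smul_preimage _)
      rintro _ ⟨i, rfl⟩
      exact hall i
    exact this hx
  obtain ⟨f, u, hfM, hfx⟩ := geometric_hahn_banach_closed_point hMconv hMc.isClosed hi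
  have hpos : ∃ y ∈ convexHull ℝ (range p), 0 < f y := by
    by_contra! hneg
    have hf0 : ∀ j, f (p j) = 0 := by
      have hs : ∑ j, f (p j) = 0 := by rw [← map_sum, hcent, map_zero]
      intro j
      exact (Finset.sum_eq_zero_iff_of_nonpos
        (fun j _ => hneg _ (subset_convexHull ℝ _ (mem_range_self j)))).1 hs j (Finset.mem_univ _)
    have hz : ∀ x, f x = 0 := by
      intro x
      rw [← hcomb x]
      simp [hf0]
    obtain ⟨m, hm⟩ := hMn
    have := hfM m hm
    rw [hz] at this hfx
    linarith
  have g := grunbaum hn hSc (convex_convexHull ℝ _) hV (centroid_integral hcent hint f) hpos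
  have b := bm_pt (A := cap (convexHull ℝ (range p)) f 0) (C := convexHull ℝ (range p) \ M)
    (b := p i) (s := ε) (t := 1 - ε) hε0 (by
      rintro z ⟨hz, hfz⟩
      refine ⟨convex_convexHull ℝ _ hz (subset_convexHull ℝ _ (mem_range_self i)) hε0.le
        (by linarith) (by ring), fun hm => ?_⟩
      have := hfM _ hm
      rw [map_add, map_smul f ε z, smul_eq_mul] at this
      have := mul_nonneg hε0.le hfz
      linarith)
  have b' := ENNReal.toReal_mono
    ((measure_mono sdiff_subset).trans_lt hSc.measure_lt_top).ne b
  rw [ENNReal.toReal_mul, ENNReal.toReal_ofReal (by positivity)] at b'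
  refine le_trans ?_ b'
  have := mul_le_mul_of_nonneg_left g (pow_nonneg hε0.le n)
  linarith

lemma part_two (hn : 1 ≤ n) {p : Fin (n + 1) → EuclideanSpace ℝ (Fin n)} (hcent : ∑ i, p i = 0)
    (hint : (interior (convexHull ℝ (range p))).Nonempty)
    {M : Set (EuclideanSpace ℝ (Fin n))} (hMc : IsCompact M) (hMconv : Convex ℝ M)
    (hM : convexHull ℝ (range p) ⊆ M) {ε : ℝ} (hε0 : 0 < ε)
    (h : ¬ (M ⊆ (1 + ε) • convexHull ℝ (range p))) :
    ε / (n + 1) * (volume (convexHull ℝ (range p))).toReal ≤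
        (volume (M \ convexHull ℝ (range p))).toReal := by
  have hSc : IsCompact (convexHull ℝ (range p)) := (finite_range p).isCompact_convexHull ℝ
  obtain ⟨ℓ, hS, hℓp, hsum, hcomb⟩ := bary hcent hint
  obtain ⟨x, hxM, hx⟩ := not_subset.1 h
  have hmem : ∀ y, y ∈ convexHull ℝ (range p) ↔ ∀ i, 0 ≤ ℓ i y + 1 / (n + 1) := by
    intro y; rw [hS]; rfl
  have hn1 : (0:ℝ) < n + 1 := by positivity
  obtain ⟨i, hi⟩ : ∃ i, ℓ i x + 1 / (n + 1) < - (ε / (n + 1)) := by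
    by_contra! hall
    apply hx
    refine ⟨(1 + ε)⁻¹ • x, (hmem _).2 fun i => ?_, ?_⟩
    · have := hall i
      rw [map_smul, smul_eq_mul]
      have e : (1 + ε)⁻¹ * ℓ i x + 1 / (n + 1 : ℝ) =
        (1 + ε)⁻¹ * (ℓ i x + 1 / (n + 1) + ε / (n + 1)) := by field_simp; ring
      rw [e]
      exact mul_nonneg (by positivity) (by linarith)
    · simp only [smul_smul]
      rw [mul_inv_cancel₀ (by positivity), one_smul]
  set c : ℝ := 1 / (n + 1) with hc
  let T := LinearMap.transvection (ℓ i) (x - p i)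
  have hdet : LinearMap.det T = ℓ i x + c := by
    have h1 := hℓp i i
    simp only [if_true] at h1
    simp only [T, LinearMap.transvection.det, map_sub]
    linarith
  let v := c • (x - p i)
  have hTv : ∀ y, v + T y = y + (ℓ i y + c) • (x - p i) := by
    intro y
    simp only [T, v, LinearMap.transvection.apply, add_smul]
    abel
  have hvol : volume (v +ᵥ (T '' convexHull ℝ (range p))) =
      ENNReal.ofReal |ℓ i x + c| * volume (convexHull ℝ (range p)) := by
    rw [measure_vadd, Measure.addHaar_image_linearMap, hdet]
  have hsub : v +ᵥ (T '' convexHull ℝ (range p)) ⊆ M := by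
    rintro _ ⟨_, ⟨y, hy, rfl⟩, rfl⟩
    have : convexHull ℝ (range p) ⊆ T ⁻¹' ((fun z => v + z) ⁻¹' M) := by
      refine convexHull_min ?_ ((hMconv.translate_preimage_right v).linear_preimage T)
      rintro _ ⟨j, rfl⟩
      show v + T (p j) ∈ M
      rw [hTv, hℓp]
      split_ifs with hij
      · subst hij; simpa using hxM
      · simpa using hM (subset_convexHull ℝ _ (mem_range_self j))
    exact this hy
  have hnull : volume ((v +ᵥ (T '' convexHull ℝ (range p))) ∩ convexHull ℝ (range p)) = 0 := by
    have : Nontrivial (Fin (n + 1)) := Fin.nontrivial_iff_two_le.2 (by omega)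
    obtain ⟨j, hj⟩ := exists_ne i
    have hij := hℓp i j
    rw [if_neg hj.symm] at hij
    refine measure_mono_null ?_ (Measure.addHaar_affineSubspace volume
      (AffineSubspace.mk' (p j) (LinearMap.ker (ℓ i))) ?_)
    · rintro _ ⟨⟨_, ⟨y, hy, rfl⟩, rfl⟩, hz⟩
      simp only [vadd_eq_add] at hz ⊢
      rw [hTv] at hz ⊢
      have h1 := (hmem _).1 hz i
      have h2 := (hmem _).1 hy i
      have hii := hℓp i i
      simp only [if_true] at hii
      rw [SetLike.mem_coe, AffineSubspace.mem_mk', LinearMap.mem_ker, vsub_eq_sub, map_sub]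
      have e : ℓ i (y + (ℓ i y + c) • (x - p i)) + c = (ℓ i y + c) * (ℓ i x + c) := by
        rw [map_add, map_smul, map_sub, smul_eq_mul]
        linear_combination -(ℓ i y + c) * hii
      have hneg : ℓ i x + c ≤ 0 := hi.le.trans (neg_nonpos.2 (by positivity))
      have := mul_nonpos_of_nonneg_of_nonpos h2 hneg
      linarith
    · intro htop
      have hd := congrArg AffineSubspace.direction htop
      rw [AffineSubspace.direction_mk', AffineSubspace.direction_top] at hd
      have hii := hℓp i i
      simp only [if_true] at hii
      have : p i - p j ∈ LinearMap.ker (ℓ i) := by rw [hd]; trivial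
      rw [LinearMap.mem_ker, map_sub] at this
      linarith
  have hle : volume (v +ᵥ (T '' convexHull ℝ (range p))) ≤ volume (M \ convexHull ℝ (range p)) := by
    rw [← measure_sdiff_null' hnull]
    exact measure_mono (sdiff_subset_sdiff_left hsub)
  rw [hvol] at hle
  have h3 := ENNReal.toReal_mono ((measure_mono sdiff_subset).trans_lt hMc.measure_lt_top).ne hle
  rw [ENNReal.toReal_mul, ENNReal.toReal_ofReal (abs_nonneg _)] at h3
  refine le_trans (mul_le_mul_of_nonneg_right ?_ ENNReal.toReal_nonneg) h3
  exact le_trans (by linarith) (neg_le_abs _)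

end helpers

theorem vol_diff_from_regular_simplex
    (n : ℕ) (hn : 1 ≤ n) (p : Fin (n + 1) → EuclideanSpace ℝ (Fin n))
    (d : ℝ) (hd : 0 < d) (hreg : ∀ i j, i ≠ j → dist (p i) (p j) = d)
    (hcent : ∑ i, p i = 0)
    (M₁ M₂ : Set (EuclideanSpace ℝ (Fin n)))
    (hM₁comp : IsCompact M₁) (hM₁conv : Convex ℝ M₁) (hM₁int : (interior M₁).Nonempty)
    (hM₂comp : IsCompact M₂) (hM₂conv : Convex ℝ M₂) (hM₂int : (interior M₂).Nonempty)
    (hM₁ : M₁ ⊆ convexHull ℝ (Set.range p)) (hM₂ : convexHull ℝ (Set.range p) ⊆ M₂)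
    (ε : ℝ) (hε0 : 0 < ε) (hε1 : ε < 1) :
    (¬ ((1 - ε) • convexHull ℝ (Set.range p) ⊆ M₁) →
      ((n : ℝ) / (n + 1)) ^ n * ε ^ n * (volume (convexHull ℝ (Set.range p))).toReal ≤
        (volume (convexHull ℝ (Set.range p) \ M₁)).toReal ∧
      (Real.exp 1)⁻¹ * ε ^ n * (volume (convexHull ℝ (Set.range p))).toReal <
        ((n : ℝ) / (n + 1)) ^ n * ε ^ n * (volume (convexHull ℝ (Set.range p))).toReal ∧
      (Real.exp 1)⁻¹ * ε ^ n * (volume (convexHull ℝ (Set.range p))).toReal <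
        (volume (convexHull ℝ (Set.range p) \ M₁)).toReal) ∧
    (¬ (M₂ ⊆ (1 + ε) • convexHull ℝ (Set.range p)) →
      ε / (n + 1) * (volume (convexHull ℝ (Set.range p))).toReal ≤
        (volume (M₂ \ convexHull ℝ (Set.range p))).toReal) := by
  have hint : (interior (convexHull ℝ (Set.range p))).Nonempty := hM₁int.mono (interior_mono hM₁)
  have hSc : IsCompact (convexHull ℝ (range p)) := (finite_range p).isCompact_convexHull ℝ
  have hVp : 0 < (volume (convexHull ℝ (range p))).toReal :=
    ENNReal.toReal_pos (Measure.measure_pos_of_nonempty_interior _ hint).ne' hSc.measure_lt_top.ne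
  refine ⟨fun h => ?_, fun h => part_two hn hcent hint hM₂comp hM₂conv hM₂ hε0 h⟩
  have h1 := part_one hn hcent hint hM₁comp hM₁conv (hM₁int.mono interior_subset) hε0 hε1 h
  have h2 : (Real.exp 1)⁻¹ * ε ^ n * (volume (convexHull ℝ (Set.range p))).toReal <
        ((n : ℝ) / (n + 1)) ^ n * ε ^ n * (volume (convexHull ℝ (Set.range p))).toReal :=
    mul_lt_mul_of_pos_right (mul_lt_mul_of_pos_right (exp_bound hn) (by positivity)) hVp
  exact ⟨h1, h2, h2.trans_le h1⟩

end
end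

section
/- Let g(t) = (2π)^{−1/2}e^{−t²/2} be the standard Gaussian density, and for s ∈ ℝ let g_s be the truncated Gaussian density g_s(x) = g(x−s)/∫_0^∞ g(t−s)dt for x ≥ 0 and g_s(x) = 0 for x < 0. Let φ_s : (0,∞) → ℝ and ψ_s : ℝ → (0,∞) be the transport maps determined by ∫_0^x g_s = ∫_{−∞}^{φ_s(x)} g and ∫_{−∞}^y g = ∫_0^{ψ_s(y)} g_s (so φ_s and ψ_s are mutually inverse). Then for every s ∈ [0, 0.15]: (i) if x ∈ [0.74, 0.77], then 0 < φ_s(x) < 0.16, 1.3 ≤ φ_s'(x) ≤ 2.05 and φ_s''(x) ≤ −0.25; (ii) if y ∈ [0, 0.15], then 0 < ψ_s(y) < 0.85, 0.49 ≤ ψ_s'(y) ≤ 0.77 and ψ_s''(y) ≥ 0.07. -/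
open MeasureTheory Set

noncomputable section

/-- The standard Gaussian density `g(t) = (2π)^{-1/2} e^{-t²/2}`. -/
def stdGauss (t : ℝ) : ℝ := (Real.sqrt (2 * Real.pi))⁻¹ * Real.exp (-t ^ 2 / 2)

/-- The truncated Gaussian density
`g_s(x) = g(x-s)/∫_0^∞ g(t-s) dt` for `x ≥ 0`, and `g_s(x) = 0` for `x < 0`. -/
def truncGauss (s x : ℝ) : ℝ :=
  if 0 ≤ x then stdGauss (x - s) / (∫ t in Ioi (0 : ℝ), stdGauss (t - s)) else 0

/-- Unnormalised Gaussian. -/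
def gE (t : ℝ) : ℝ := Real.exp (-t ^ 2 / 2)
/-- Its primitive vanishing at zero. -/
def gJ (t : ℝ) : ℝ := ∫ τ in (0:ℝ)..t, gE τ
/-- The normalising constant. -/
def gR : ℝ := Real.sqrt (2 * Real.pi)

lemma gE_pos (t : ℝ) : 0 < gE t := Real.exp_pos _
lemma gE_cont : Continuous gE := by unfold gE; fun_prop
lemma gE_deriv (t : ℝ) : HasDerivAt gE (-t * gE t) t := by
  have h : HasDerivAt (fun t : ℝ => -t ^ 2 / 2) (-t) t := by
    have := ((hasDerivAt_pow 2 t).neg).div_const 2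
    refine this.congr_deriv ?_
    norm_num
    ring
  have := h.exp
  unfold gE
  refine this.congr_deriv ?_
  ring
lemma gJ_strict (t : ℝ) : HasStrictDerivAt gJ (gE t) t :=
  intervalIntegral.integral_hasStrictDerivAt_right (gE_cont.intervalIntegrable _ _)
    (gE_cont.stronglyMeasurable.stronglyMeasurableAtFilter) gE_cont.continuousAt
lemma gJ_deriv (t : ℝ) : HasDerivAt gJ (gE t) t := (gJ_strict t).hasDerivAt
lemma gJ_mono : StrictMono gJ := by
  apply strictMono_of_deriv_pos
  intro x
  rw [(gJ_deriv x).deriv]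
  exact gE_pos x
lemma gJ_zero : gJ 0 = 0 := by simp [gJ]

lemma gK_deriv (z : ℝ) : HasDerivAt (Function.invFun gJ) (gE z)⁻¹ (gJ z) := by
  have hinv : ∀ z, Function.invFun gJ (gJ z) = z := Function.leftInverse_invFun gJ_mono.injective
  have hmap : Filter.map gJ (nhds z) = nhds (gJ z) :=
    (gJ_strict z).map_nhds_eq (gE_pos z).ne'
  refine HasDerivAt.of_local_left_inverse (f := gJ) ?_ ?_ (gE_pos z).ne' ?_
  · unfold ContinuousAt
    rw [← hmap, Filter.tendsto_map'_iff, hinv]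
    have : Function.invFun gJ ∘ gJ = id := funext hinv
    rw [this]; exact Filter.tendsto_id
  · rw [hinv]; exact gJ_deriv z
  · rw [← hmap, Filter.eventually_map]
    exact Filter.Eventually.of_forall fun y => by rw [hinv]

lemma impl_deriv {U : Set ℝ} (hU : IsOpen U) (h m : ℝ → ℝ) (c a : ℝ)
    (hm : ∀ x ∈ U, gJ (h x) = m x) (hm' : ∀ x ∈ U, HasDerivAt m (c * gE (x - a)) x)
    (x : ℝ) (hx : x ∈ U) :
    HasDerivAt h (c * gE (x - a) / gE (h x)) x := by
  have h1 := gK_deriv (h x)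
  rw [hm x hx] at h1
  have h2 := h1.comp x (hm' x hx)
  have h3 : h =ᶠ[nhds x] Function.invFun gJ ∘ m := by
    filter_upwards [hU.mem_nhds hx] with y hy
    simp only [Function.comp]
    rw [← hm y hy]
    exact (Function.leftInverse_invFun gJ_mono.injective _).symm
  refine (h2.congr_of_eventuallyEq h3).congr_deriv ?_
  rw [div_eq_inv_mul]

lemma impl_deriv2 {U : Set ℝ} (hU : IsOpen U) (h m : ℝ → ℝ) (c a : ℝ)
    (hm : ∀ x ∈ U, gJ (h x) = m x) (hm' : ∀ x ∈ U, HasDerivAt m (c * gE (x - a)) x)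
    (x : ℝ) (hx : x ∈ U) :
    deriv (deriv h) x = (c * gE (x - a) / gE (h x)) *
      (-(x - a) + h x * (c * gE (x - a) / gE (h x))) := by
  have key := impl_deriv hU h m c a hm hm'
  have h3 : deriv h =ᶠ[nhds x] fun x => c * gE (x - a) / gE (h x) := by
    filter_upwards [hU.mem_nhds hx] with y hy
    exact (key y hy).deriv
  rw [h3.deriv_eq]
  have e1 : HasDerivAt (fun x => c * gE (x - a)) (c * (-(x - a) * gE (x - a))) x :=
    (((gE_deriv (x - a)).comp_sub_const x a)).const_mul c
  have e2 := (gE_deriv (h x)).comp x (key x hx)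
  have := (e1.div e2 (gE_pos _).ne').deriv
  refine Eq.trans this ?_
  have := (gE_pos (h x)).ne'
  simp only [Function.comp]
  field_simp
  ring

lemma gR_pos : 0 < gR := Real.sqrt_pos.2 (by positivity)
lemma gR_lo : 2.506 < gR := by
  unfold gR
  apply Real.lt_sqrt_of_sq_lt
  have := Real.pi_gt_d4
  norm_num at *; linarith
lemma gR_hi : gR < 2.507 := by
  unfold gR
  rw [Real.sqrt_lt' (by norm_num)]
  have := Real.pi_lt_d4
  norm_num at *; linarith

lemma stdG (t : ℝ) : stdGauss t = gR⁻¹ * gE t := rfl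
lemma gE_int : Integrable gE := by
  have := integrable_exp_neg_mul_sq (b := 1/2) (by norm_num)
  convert this using 2
  unfold gE; congr 1; ring
lemma gE_Ioi : ∫ t in Ioi (0:ℝ), gE t = gR / 2 := by
  have := integral_gaussian_Ioi (1/2)
  unfold gR
  rw [show 2 * Real.pi = Real.pi / (1/2) by ring, ← this]
  congr 1; ext t; unfold gE; congr 1; ring
lemma gE_even (t : ℝ) : gE (-t) = gE t := by unfold gE; congr 1; ring
lemma gE_Iic : ∫ t in Iic (0:ℝ), gE t = gR / 2 := by
  rw [← gE_Ioi]
  have := integral_comp_neg_Iic 0 gE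
  simpa [gE_even] using this
lemma gE_Iic' (y : ℝ) : ∫ t in Iic y, gE t = gR / 2 + gJ y := by
  have := intervalIntegral.integral_Iic_sub_Iic (f := gE) (μ := volume) (a := 0) (b := y)
    gE_int.integrableOn gE_int.integrableOn
  rw [gE_Iic] at this
  unfold gJ; linarith
lemma std_Iic (y : ℝ) : ∫ t in Iic y, stdGauss t = 1 / 2 + gJ y / gR := by
  simp only [stdG]
  rw [integral_const_mul, gE_Iic']
  have := gR_pos
  field_simp
lemma gE_shift (s : ℝ) : ∫ t in Ioi (0:ℝ), gE (t - s) = gR / 2 + gJ s := by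
  have h1 : ∫ t in Ioi (0:ℝ), gE (t - s) = ∫ t in Iic (0:ℝ), gE (t + s) := by
    have := integral_comp_neg_Iic 0 (fun t => gE (t - s))
    rw [neg_zero] at this
    rw [← this]
    congr 1; ext t; rw [← gE_even]; congr 1; ring
  rw [h1, ← gE_Iic' s]
  have := (measurePreserving_add_right volume s).setIntegral_preimage_emb
    (measurableEmbedding_addRight s) gE (Iic s)
  rw [← this]
  congr 2
  ext t; simp
lemma Z_eq (s : ℝ) : ∫ t in Ioi (0 : ℝ), stdGauss (t - s) = 1 / 2 + gJ s / gR := by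
  simp only [stdG]
  rw [integral_const_mul, gE_shift]
  have := gR_pos
  field_simp
lemma gJ_odd (s : ℝ) : gJ (-s) = - gJ s := by
  unfold gJ
  have := intervalIntegral.integral_comp_neg (a := 0) (b := s) gE
  simp only [gE_even, neg_zero] at this
  rw [this, intervalIntegral.integral_symm]
lemma trunc_int (s x : ℝ) (hx : 0 ≤ x) : ∫ t in Ioc (0 : ℝ) x, truncGauss s t =
    (gJ (x - s) + gJ s) / gR / (1 / 2 + gJ s / gR) := by
  have h1 : ∫ t in Ioc (0 : ℝ) x, truncGauss s t =
      ∫ t in Ioc (0 : ℝ) x, (gR⁻¹ / (1 / 2 + gJ s / gR)) * gE (t - s) := by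
    apply setIntegral_congr_fun measurableSet_Ioc
    intro t ht
    simp only [truncGauss, ht.1.le, if_true, Z_eq]
    rw [stdG]
    ring
  rw [h1, integral_const_mul, ← intervalIntegral.integral_of_le hx,
    intervalIntegral.integral_comp_sub_right gE s]
  have := intervalIntegral.integral_interval_sub_left (μ := volume) (f := gE) (a := 0) (b := x - s)
    (c := 0 - s) (gE_cont.intervalIntegrable _ _) (gE_cont.intervalIntegrable _ _)
  rw [← this]
  change _ * (gJ (x - s) - gJ (0 - s)) = _
  rw [zero_sub, gJ_odd]
  ring

/-! numerical bounds -/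
lemma exp_hi {w : ℝ} (hw : 0 ≤ w) : Real.exp (-w) ≤ 1 - w + w^2/2 := by
  have h := Real.quadratic_le_exp_of_nonneg hw
  have h2 : Real.exp (-w) * Real.exp w = 1 := by rw [← Real.exp_add]; simp
  have h3 := Real.exp_pos (-w)
  have h4 : Real.exp (-w) * (1 + w + w^2/2) ≤ 1 := by
    exact (mul_le_mul_of_nonneg_left h h3.le).trans h2.le
  have h5 : (1 - w + w^2/2) * (1 + w + w^2/2) = 1 + w^4/4 := by ring
  have h6 : 0 < 1 + w + w^2/2 := by positivity
  have h7 : 0 ≤ w^4/4 := by positivity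
  exact le_of_mul_le_mul_right (by linarith) h6
lemma exp_lo {w : ℝ} (hw : 0 ≤ w) : 1 - w + w^2/2 - w^3/6 ≤ Real.exp (-w) := by
  let f : ℝ → ℝ := fun w => Real.exp (-w) - (1 - w + w^2/2 - w^3/6)
  have hd : ∀ x, HasDerivAt f (-Real.exp (-x) + (1 - x + x^2/2)) x := by
    intro x
    have h1 : HasDerivAt (fun x : ℝ => Real.exp (-x)) (Real.exp (-x) * (-1)) x :=
      (hasDerivAt_neg x).exp
    have h2 := ((((hasDerivAt_const x (1:ℝ)).sub (hasDerivAt_id x)).add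
      ((hasDerivAt_pow 2 x).div_const 2)).sub ((hasDerivAt_pow 3 x).div_const 6))
    refine (h1.sub h2).congr_deriv ?_
    norm_num
    ring
  have hmono : MonotoneOn f (Ici 0) := by
    apply monotoneOn_of_deriv_nonneg (convex_Ici 0)
    · exact fun x _ => (hd x).continuousAt.continuousWithinAt
    · exact fun x _ => (hd x).differentiableAt.differentiableWithinAt
    · intro x hx
      rw [interior_Ici] at hx
      rw [(hd x).deriv]
      have := exp_hi (le_of_lt hx)
      linarith
  have := hmono (mem_Ici.2 le_rfl) (mem_Ici.2 hw) hw
  simp only [f] at this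
  norm_num at this
  linarith
lemma gE_lo (t : ℝ) : 1 - t^2/2 + t^4/8 - t^6/48 ≤ gE t := by
  have := exp_lo (w := t^2/2) (by positivity)
  unfold gE
  rw [neg_div]
  refine le_trans (le_of_eq ?_) this
  ring
lemma gE_hi (t : ℝ) : gE t ≤ 1 - t^2/2 + t^4/8 := by
  have := exp_hi (w := t^2/2) (by positivity)
  unfold gE
  rw [neg_div]
  refine le_trans this (le_of_eq ?_)
  ring
lemma gE_le_one (t : ℝ) : gE t ≤ 1 := by
  unfold gE; rw [Real.exp_le_one_iff]; nlinarith [sq_nonneg t]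
lemma gE_anti {a b : ℝ} (ha : 0 ≤ a) (h : a ≤ b) : gE b ≤ gE a := by
  unfold gE; rw [Real.exp_le_exp]; nlinarith
lemma gJ_sub (a b : ℝ) : gJ b - gJ a = ∫ t in a..b, gE t :=
  intervalIntegral.integral_interval_sub_left (gE_cont.intervalIntegrable _ _)
    (gE_cont.intervalIntegrable _ _)
lemma gJ_lo {t : ℝ} (ht : 0 ≤ t) : t - t^3/6 + t^5/40 - t^7/336 ≤ gJ t := by
  have : ∫ x in (0:ℝ)..t, (1 - x^2/2 + x^4/8 - x^6/48) ≤ gJ t :=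
    intervalIntegral.integral_mono_on ht (Continuous.intervalIntegrable (by fun_prop) _ _)
      (gE_cont.intervalIntegrable _ _) fun x _ => gE_lo x
  refine le_trans (le_of_eq ?_) this
  rw [intervalIntegral.integral_sub, intervalIntegral.integral_add, intervalIntegral.integral_sub]
  · simp; ring
  all_goals exact Continuous.intervalIntegrable (by fun_prop) _ _
lemma gJ_hi {t : ℝ} (ht : 0 ≤ t) : gJ t ≤ t - t^3/6 + t^5/40 := by
  have : gJ t ≤ ∫ x in (0:ℝ)..t, (1 - x^2/2 + x^4/8) :=
    intervalIntegral.integral_mono_on ht 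
      (gE_cont.intervalIntegrable _ _) (Continuous.intervalIntegrable (by fun_prop) _ _)
      fun x _ => gE_hi x
  refine le_trans this (le_of_eq ?_)
  rw [intervalIntegral.integral_add, intervalIntegral.integral_sub]
  · simp; ring
  all_goals exact Continuous.intervalIntegrable (by fun_prop) _ _
lemma gE_85 : 0.69 ≤ gE 0.85 := by
  have := gE_lo 0.85
  norm_num at *; linarith
lemma gJ_sub_le {a b : ℝ} (h : a ≤ b) : gJ b - gJ a ≤ b - a := by
  rw [gJ_sub]
  have := intervalIntegral.integral_mono_on (μ := volume) h (gE_cont.intervalIntegrable a b)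
    (intervalIntegrable_const (c := (1:ℝ))) fun x _ => gE_le_one x
  simpa using this
lemma gJ_sub_ge {a b : ℝ} (ha : 0 ≤ a) (h : a ≤ b) (hb : b ≤ 0.85) :
    0.69 * (b - a) ≤ gJ b - gJ a := by
  rw [gJ_sub]
  have := intervalIntegral.integral_mono_on (μ := volume) h
    (intervalIntegrable_const (c := (0.69:ℝ)))
    (gE_cont.intervalIntegrable a b)
    fun x hx => gE_85.trans (gE_anti (ha.trans hx.1) (hx.2.trans hb))
  simp at this
  linarith

lemma gJ_nonneg {s : ℝ} (h : 0 ≤ s) : 0 ≤ gJ s := by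
  rw [← gJ_zero]; exact gJ_mono.monotone h
lemma gJ_le {s : ℝ} (h : 0 ≤ s) : gJ s ≤ s := by
  have := gJ_sub_le h
  rw [gJ_zero] at this; linarith

/-- The mass `P` of the half line. -/
def gP (s : ℝ) : ℝ := 1 / 2 + gJ s / gR
lemma gP_lo {s : ℝ} (h : 0 ≤ s) : 1 / 2 ≤ gP s := by
  have := div_nonneg (gJ_nonneg h) gR_pos.le
  unfold gP; linarith
lemma gP_hi {s : ℝ} (h : 0 ≤ s) : gP s ≤ 1 / 2 + 0.4 * s := by
  have h1 : gJ s / gR ≤ 0.4 * s := by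
    rw [div_le_iff₀ gR_pos]
    have := gJ_le h
    have := gR_lo
    norm_num at *
    nlinarith
  unfold gP; linarith
lemma gP_mul (s : ℝ) : gP s * gR = gR / 2 + gJ s := by
  have := gR_pos
  unfold gP; field_simp

lemma num_a {s : ℝ} (h0 : 0 ≤ s) (h1 : s ≤ 0.15) : gJ 0.5 + gJ s / 2 < gR / 4 := by
  have a := gJ_hi (t := 0.5) (by norm_num)
  have b := gJ_le h0
  have := gR_lo
  norm_num at *; linarith
lemma num_b {s : ℝ} (h0 : 0 ≤ s) (h1 : s ≤ 0.15) : gR / 4 < gJ (0.74 - s) + gJ s / 2 := by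
  have a := gJ_lo (t := 0.59) (by norm_num)
  have a' := gJ_lo (t := 0.15) (by norm_num)
  have b := gJ_sub_le h1
  have c := gJ_sub_ge (a := 0.59) (b := 0.74 - s) (by norm_num) (by norm_num at *; linarith)
    (by norm_num at *; linarith)
  have := gR_hi
  norm_num at *; linarith
lemma num_c {s : ℝ} (h0 : 0 ≤ s) (h1 : s ≤ 0.15) :
    gJ (0.77 - s) + gJ s / 2 < gR / 4 + gJ 0.16 / 2 := by
  have a := gJ_hi (t := 0.77) (by norm_num)
  have a' := gJ_lo (t := 0.16) (by norm_num)
  have b := gJ_le h0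
  have c := gJ_sub_ge (a := 0.77 - s) (b := 0.77) (by norm_num at *; linarith)
    (by norm_num at *; linarith) (by norm_num)
  have := gR_lo
  norm_num at *; linarith
lemma num_d {s : ℝ} (h0 : 0 ≤ s) (h1 : s ≤ 0.15) :
    gR / 4 + gP s * gJ 0.15 < gJ (0.85 - s) + gJ s / 2 := by
  have a := gJ_lo (t := 0.7) (by norm_num)
  have a' := gJ_le (s := 0.15) (by norm_num)
  have a2 := gJ_nonneg (s := 0.15) (by norm_num)
  have b := gJ_sub_le h1
  have p := gP_hi h0
  have q : gP s * gJ 0.15 ≤ gJ 0.15 / 2 + 0.009 := by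
    have : gP s * gJ 0.15 ≤ 0.56 * gJ 0.15 :=
      mul_le_mul_of_nonneg_right (by norm_num at *; linarith) a2
    norm_num at *; linarith
  have c := gJ_sub_ge (a := 0.7) (b := 0.85 - s) (by norm_num) (by norm_num at *; linarith)
    (by norm_num at *; linarith)
  have := gR_hi
  norm_num at *; linarith

lemma part_one_s12 (s : ℝ) (h0 : 0 ≤ s) (h1 : s ≤ 0.15) (φ : ℝ → ℝ)
    (hφ : ∀ x ∈ Ioi (0 : ℝ),
      ∫ t in Ioc (0 : ℝ) x, truncGauss s t = ∫ t in Iic (φ x), stdGauss t)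
    (x : ℝ) (hx : x ∈ Icc (0.74 : ℝ) 0.77) :
      0 < φ x ∧ φ x < 0.16 ∧
      1.3 ≤ deriv φ x ∧ deriv φ x ≤ 2.05 ∧
      deriv (deriv φ) x ≤ -0.25 := by
  have hP0 := gP_lo h0
  have hP1 := gP_hi h0
  have hP : 0 < gP s := by linarith
  have hR := gR_pos
  have hm : ∀ x ∈ Ioi (0:ℝ), gJ (φ x) = (gP s)⁻¹ * (gJ (x - s) + gJ s) - gR / 2 := by
    intro x hx
    have h := hφ x hx
    rw [trunc_int s x (le_of_lt hx), std_Iic] at h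
    change _ / gP s = _ at h
    field_simp at h ⊢
    linarith
  have hm' : ∀ x ∈ Ioi (0:ℝ), HasDerivAt
      (fun x => (gP s)⁻¹ * (gJ (x - s) + gJ s) - gR / 2) ((gP s)⁻¹ * gE (x - s)) x := by
    intro x hx
    exact ((((gJ_deriv (x - s)).comp_sub_const x s).add_const _).const_mul _).sub_const _
  obtain ⟨hx1, hx2⟩ := hx
  have hx0 : x ∈ Ioi (0:ℝ) := by simp only [mem_Ioi]; norm_num at *; linarith
  have d1 := (impl_deriv isOpen_Ioi φ _ _ s hm hm' x hx0).deriv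
  have d2 := impl_deriv2 isOpen_Ioi φ _ _ s hm hm' x hx0
  rw [← d1] at d2
  have hJ : gP s * (gR / 2 + gJ (φ x)) = gJ (x - s) + gJ s := by
    rw [hm x hx0]; field_simp; ring
  have hPR := gP_mul s
  have pos : 0 < φ x := by
    rw [← gJ_mono.lt_iff_lt, gJ_zero]
    have := num_b h0 h1
    have : gJ (0.74 - s) ≤ gJ (x - s) := gJ_mono.monotone (by linarith)
    have : 0 < gP s * gJ (φ x) := by linarith
    exact (mul_pos_iff_of_pos_left hP).1 this
  have lt : φ x < 0.16 := by
    rw [← gJ_mono.lt_iff_lt]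
    have := num_c h0 h1
    have : gJ (x - s) ≤ gJ (0.77 - s) := gJ_mono.monotone (by linarith)
    have h3 : 0 ≤ (gP s - 1/2) * gJ 0.16 :=
      mul_nonneg (by linarith) (gJ_nonneg (by norm_num))
    have : gP s * gJ (φ x) < gP s * gJ 0.16 := by linarith
    exact lt_of_mul_lt_mul_left this hP.le
  have key : deriv φ x * (gP s * gE (φ x)) = gE (x - s) := by
    have := gE_pos (φ x)
    rw [d1]; field_simp
  have E1 : 0.987 ≤ gE (φ x) := by
    refine le_trans ?_ (gE_anti pos.le lt.le)
    refine le_trans ?_ (gE_lo _)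
    norm_num
  have E2 := gE_le_one (φ x)
  have E3 : gE (x - s) ≤ 0.842 := by
    refine (gE_anti (a := 0.59) (by norm_num) (by norm_num at *; linarith)).trans ?_
    refine (gE_hi _).trans ?_
    norm_num
  have E4 : 0.73 + 0.52 * s ≤ gE (x - s) := by
    have e0 : gE (0.77 - s) ≤ gE (x - s) :=
      gE_anti (by norm_num at *; linarith) (by norm_num at *; linarith)
    have e1 : gE (0.77 - s) = gE 0.77 * Real.exp (0.77 * s - s^2/2) := by
      unfold gE; rw [← Real.exp_add]; congr 1; ring
    have e2 := Real.add_one_le_exp (0.77 * s - s^2/2)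
    have e3 : 0.74 ≤ gE 0.77 := by
      refine le_trans ?_ (gE_lo _)
      norm_num
    have e4 : 1 + 0.69 * s ≤ Real.exp (0.77 * s - s^2/2) := by norm_num at *; nlinarith
    have e5 : 0.74 * (1 + 0.69 * s) ≤ gE 0.77 * Real.exp (0.77 * s - s^2/2) :=
      mul_le_mul e3 e4 (by positivity) (gE_pos _).le
    norm_num at *; nlinarith
  have D0 : 0 < deriv φ x := by
    rw [d1]; have := gE_pos (φ x); have := gE_pos (x - s); positivity
  have q1 : gP s * gE (φ x) ≤ 1/2 + 0.4 * s := by nlinarith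
  have q2 : 0.4935 ≤ gP s * gE (φ x) := by norm_num at *; nlinarith
  have D1 : 1.3 ≤ deriv φ x := by
    have : 1.3 * (gP s * gE (φ x)) ≤ deriv φ x * (gP s * gE (φ x)) := by
      rw [key]; norm_num at *; linarith
    exact le_of_mul_le_mul_right this (by norm_num at *; linarith)
  have D2 : deriv φ x ≤ 1.71 := by
    have : deriv φ x * (gP s * gE (φ x)) ≤ 1.71 * (gP s * gE (φ x)) := by
      rw [key]; norm_num at *; linarith
    exact le_of_mul_le_mul_right this (by norm_num at *; linarith)
  refine ⟨pos, lt, D1, D2.trans (by norm_num), ?_⟩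
  rw [d2]
  have t1 : φ x * deriv φ x ≤ 0.16 * 1.71 := mul_le_mul lt.le D2 D0.le (by norm_num)
  have t2 : -(x - s) + φ x * deriv φ x ≤ -0.3 := by norm_num at *; linarith
  norm_num at *
  nlinarith

lemma part_two_s12 (s : ℝ) (h0 : 0 ≤ s) (h1 : s ≤ 0.15) (ψ : ℝ → ℝ)
    (hψ : ∀ y : ℝ,
      ∫ t in Iic y, stdGauss t = ∫ t in Ioc (0 : ℝ) (ψ y), truncGauss s t)
    (y : ℝ) (hy : y ∈ Icc (0 : ℝ) 0.15) :
      0 < ψ y ∧ ψ y < 0.85 ∧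
      0.49 ≤ deriv ψ y ∧ deriv ψ y ≤ 0.77 ∧
      0.07 ≤ deriv (deriv ψ) y := by
  have hP0 := gP_lo h0
  have hP1 := gP_hi h0
  have hP : 0 < gP s := by linarith
  have hR := gR_pos
  have hpos : ∀ y, 0 < ψ y := by
    intro y
    by_contra hcon
    have h := hψ y
    rw [Ioc_eq_empty hcon, setIntegral_empty] at h
    have hp : 0 < ∫ t in Iic y, stdGauss t := by
      simp only [stdG]
      rw [integral_const_mul]
      refine mul_pos (inv_pos.2 hR) ?_
      rw [setIntegral_pos_iff_support_of_nonneg_ae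
        (Filter.Eventually.of_forall fun t => (gE_pos t).le) gE_int.integrableOn]
      have : Function.support gE = univ := by
        ext t; simp [(gE_pos t).ne']
      rw [this]; simp
    linarith
  set h : ℝ → ℝ := fun y => ψ y - s with hh
  have hm : ∀ y ∈ (univ : Set ℝ), gJ (h y) = gP s * (gR / 2 + gJ y) - gJ s := by
    intro y _
    have e := hψ y
    rw [trunc_int s _ (hpos y).le, std_Iic] at e
    change _ = _ / gP s at e
    change gJ (ψ y - s) = _
    field_simp at e
    linarith
  have hm' : ∀ y ∈ (univ : Set ℝ), HasDerivAt
      (fun y => gP s * (gR / 2 + gJ y) - gJ s) (gP s * gE (y - 0)) y := by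
    intro y _
    rw [sub_zero]
    exact (((gJ_deriv y).const_add _).const_mul _).sub_const _
  obtain ⟨hy1, hy2⟩ := hy
  have d1 := (impl_deriv isOpen_univ h _ _ 0 hm hm' y trivial).deriv
  have d2 := impl_deriv2 isOpen_univ h _ _ 0 hm hm' y trivial
  rw [← d1] at d2
  have dd : deriv h = deriv ψ := by
    funext y; exact deriv_sub_const s
  rw [dd] at d1 d2
  rw [sub_zero] at d1 d2
  have hJ := hm y trivial
  have hPR := gP_mul s
  have u1 : 0.5 ≤ h y := by
    rw [← gJ_mono.le_iff_le]
    have := num_a h0 h1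
    have : 0 ≤ gP s * gJ y := mul_nonneg hP.le (gJ_nonneg hy1)
    linarith
  have u2 : h y < 0.85 - s := by
    rw [← gJ_mono.lt_iff_lt]
    have := num_d h0 h1
    have : gP s * gJ y ≤ gP s * gJ 0.15 :=
      mul_le_mul_of_nonneg_left (gJ_mono.monotone hy2) hP.le
    linarith
  have key : deriv ψ y * gE (h y) = gP s * gE y := by
    have := gE_pos (h y)
    rw [d1]; field_simp
  have E1 : 0.988 ≤ gE y := by
    refine le_trans ?_ (gE_anti hy1 hy2)
    refine le_trans ?_ (gE_lo _)
    norm_num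
  have E2 := gE_le_one y
  have E3 : gE (h y) ≤ 0.883 := by
    refine (gE_anti (a := 0.5) (by norm_num) u1).trans ?_
    refine (gE_hi _).trans ?_
    norm_num
  have E4 : 0.69 + 0.53 * s ≤ gE (h y) := by
    have e0 : gE (0.85 - s) ≤ gE (h y) :=
      gE_anti (by norm_num at *; linarith) u2.le
    have e1 : gE (0.85 - s) = gE 0.85 * Real.exp (0.85 * s - s^2/2) := by
      unfold gE; rw [← Real.exp_add]; congr 1; ring
    have e2 := Real.add_one_le_exp (0.85 * s - s^2/2)
    have e3 := gE_85
    have e4 : 1 + 0.77 * s ≤ Real.exp (0.85 * s - s^2/2) := by norm_num at *; nlinarith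
    have e5 : 0.69 * (1 + 0.77 * s) ≤ gE 0.85 * Real.exp (0.85 * s - s^2/2) :=
      mul_le_mul e3 e4 (by positivity) (gE_pos _).le
    norm_num at *; nlinarith
  have q1 : gP s * gE y ≤ 1/2 + 0.4 * s := by nlinarith
  have q2 : 0.494 ≤ gP s * gE y := by norm_num at *; nlinarith
  have D1 : 0.559 ≤ deriv ψ y := by
    have : 0.559 * gE (h y) ≤ deriv ψ y * gE (h y) := by
      rw [key]; norm_num at *; linarith
    exact le_of_mul_le_mul_right this (gE_pos _)
  have D2 : deriv ψ y ≤ 0.77 := by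
    have : deriv ψ y * gE (h y) ≤ 0.77 * gE (h y) := by
      rw [key]; norm_num at *; linarith
    exact le_of_mul_le_mul_right this (gE_pos _)
  refine ⟨hpos y, ?_, le_trans (by norm_num) D1, D2, ?_⟩
  · have : ψ y - s < 0.85 - s := u2
    linarith
  rw [d2]
  have t1 : 0.5 * 0.559 ≤ h y * deriv ψ y :=
    mul_le_mul u1 D1 (by norm_num) (le_trans (by norm_num) u1)
  have t2 : 0.1295 ≤ -y + h y * deriv ψ y := by norm_num at *; linarith
  have t3 : 0.559 * 0.1295 ≤ deriv ψ y * (-y + h y * deriv ψ y) :=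
    mul_le_mul D1 t2 (by norm_num) (le_trans (by norm_num) D1)
  exact le_trans (by norm_num) t3

theorem transport_map_derivative_bounds
    (s : ℝ) (hs : s ∈ Icc (0 : ℝ) 0.15)
    (φ ψ : ℝ → ℝ)
    (hφ : ∀ x ∈ Ioi (0 : ℝ),
      ∫ t in Ioc (0 : ℝ) x, truncGauss s t = ∫ t in Iic (φ x), stdGauss t)
    (hψ : ∀ y : ℝ,
      ∫ t in Iic y, stdGauss t = ∫ t in Ioc (0 : ℝ) (ψ y), truncGauss s t) :
    (∀ x ∈ Icc (0.74 : ℝ) 0.77,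
      0 < φ x ∧ φ x < 0.16 ∧
      1.3 ≤ deriv φ x ∧ deriv φ x ≤ 2.05 ∧
      deriv (deriv φ) x ≤ -0.25) ∧
    (∀ y ∈ Icc (0 : ℝ) 0.15,
      0 < ψ y ∧ ψ y < 0.85 ∧
      0.49 ≤ deriv ψ y ∧ deriv ψ y ≤ 0.77 ∧
      0.07 ≤ deriv (deriv ψ) y) := by
  exact ⟨fun x hx => part_one_s12 s hs.1 hs.2 φ hφ x hx, fun y hy => part_two_s12 s hs.1 hs.2 ψ hψ y hy⟩

end
end
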